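/- Let F ∈ ℱ_reg be a regular hypersurface of degree M in ℙ^M (M ≥ 10), o ∈ F a singular point with local equation q_2 + q_3 + ... + q_M, D_2 = {q_2|_F = 0} the first hypertangent divisor at o, and P ⊂ F the section of F by an arbitrary linear subspace of ℙ^M of codimension two containing o. Then the restriction D_2|_P is an irreducible and reduced divisor on the hypersurface P ⊂ ℙ^{M−2}. -/

import Mathlib

/-!
Shared elementary framework: the Zariski topology on a complex vector space,
dimension of subsets (topological Krull dimension), rank of quadratic forms,
and the space 𝒫^sing of polynomials `f = q₂ + q₃ + ⋯ + q_M`.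
-/

noncomputable section

open MvPolynomial

/-- A polynomial function on a complex vector space: a polynomial expression in
finitely many linear functionals. -/
def IsPolyFun {E : Type*} [AddCommGroup E] [Module ℂ E] (g : E → ℂ) : Prop :=
  ∃ (n : ℕ) (φ : E →ₗ[ℂ] (Fin n → ℂ)) (p : MvPolynomial (Fin n) ℂ),
    ∀ v, g v = MvPolynomial.eval (φ v) p

/-- Zariski-closed subsets of a complex vector space: common zero loci of families
of polynomial functions. -/
def IsZClosed {E : Type*} [AddCommGroup E] [Module ℂ E] (A : Set E) : Prop :=
  ∃ G : Set (E → ℂ), (∀ g ∈ G, IsPolyFun g) ∧ A = {v | ∀ g ∈ G, g v = 0}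

/-- The Zariski topology on a complex vector space. -/
def zariskiTopology (E : Type*) [AddCommGroup E] [Module ℂ E] : TopologicalSpace E :=
  TopologicalSpace.generateFrom {U | IsZClosed Uᶜ}

/-- A subset is Zariski open. -/
def IsZOpen {E : Type*} [AddCommGroup E] [Module ℂ E] (A : Set E) : Prop :=
  @IsOpen E (zariskiTopology E) A

/-- The dimension of a subset of a complex vector space: the topological Krull
dimension in the induced Zariski topology. -/
def zdim {E : Type*} [AddCommGroup E] [Module ℂ E] (A : Set E) : WithBot ℕ∞ :=
  @topologicalKrullDim A (TopologicalSpace.induced Subtype.val (zariskiTopology E))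

/-- The Zariski closure of a subset of a complex vector space. -/
def zclosure {E : Type*} [AddCommGroup E] [Module ℂ E] (A : Set E) : Set E :=
  @closure E (zariskiTopology E) A

/-- The rank of the quadratic form `q` on a subset `A ⊆ ℂ^n`: the least number of
squares of linear forms expressing `q` on `A` (over `ℂ` this is the rank of the
restriction of `q`). -/
def rankOn {n : ℕ} (q : MvPolynomial (Fin n) ℂ) (A : Set (Fin n → ℂ)) : ℕ :=
  sInf {r : ℕ | ∃ l : Fin r → ((Fin n → ℂ) →ₗ[ℂ] ℂ),
    ∀ z ∈ A, MvPolynomial.eval z q = ∑ i, l i z ^ 2}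

/-- The space 𝒫^sing of polynomials `f = q₂ + q₃ + ⋯ + q_M` in `M` variables:
polynomials of total degree at most `M` whose homogeneous components of degree 0
and 1 vanish. -/
def Psing (M : ℕ) : Submodule ℂ (MvPolynomial (Fin M) ℂ) :=
  (MvPolynomial.restrictTotalDegree (Fin M) ℂ M) ⊓
    (LinearMap.ker (MvPolynomial.homogeneousComponent 0) ⊓
     LinearMap.ker (MvPolynomial.homogeneousComponent 1))

/-- The affine expansion of a homogeneous form `G` at a point `v` of the affine chart
`{z_j = 1}` (so `v j = 1`): substitute `z_j ↦ v_j` and `z_i ↦ v_i + t_i` for `i ≠ j`.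
Its homogeneous components are the terms `q_k` of the local affine equation at `v`. -/
def chartShift {N : ℕ} (G : MvPolynomial (Fin N) ℂ) (v : Fin N → ℂ) (j : Fin N) :
    MvPolynomial (Fin N) ℂ :=
  MvPolynomial.bind₁
    (fun i => if i = j then MvPolynomial.C (v i) else MvPolynomial.C (v i) + MvPolynomial.X i) G

/-- The `k`-th term of the local affine equation of `{G = 0}` at the point `v` of the
chart `{z_j = 1}`. -/
def chartComp {N : ℕ} (k : ℕ) (G : MvPolynomial (Fin N) ℂ) (v : Fin N → ℂ) (j : Fin N) :
    MvPolynomial (Fin N) ℂ :=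
  MvPolynomial.homogeneousComponent k (chartShift G v j)

/-- `C` is an irreducible component of `Z` (with respect to the Zariski topology):
a maximal irreducible subset of `Z`. -/
def IsIrredCompOf {E : Type*} [AddCommGroup E] [Module ℂ E] (C Z : Set E) : Prop :=
  C ⊆ Z ∧ @IsIrreducible E (zariskiTopology E) C ∧
    ∀ C' : Set E, C ⊆ C' → C' ⊆ Z → @IsIrreducible E (zariskiTopology E) C' → C' = C

/-- The space ℱ of hypersurfaces of degree `M` in `ℙ^M` (as the space of homogeneous
forms of degree `M` in `M+1` variables; codimensions of cone-invariant subsets agree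
with those in the projectivisation). -/
abbrev FSpace (M : ℕ) := ↥(MvPolynomial.homogeneousSubmodule (Fin (M + 1)) ℂ M)

section RegularityConditions

variable {M : ℕ} (G : MvPolynomial (Fin (M + 1)) ℂ) (v : Fin (M + 1) → ℂ) (j : Fin (M + 1))

/-- Condition (R1.1) at a non-singular point `o = v` of `F = {G = 0}` (chart `z_j = 1`):
the sequence `q₁, …, q_{M−1}` is regular in `𝒪_{o,ℙ}`, i.e. the system
`q₁ = ⋯ = q_{M−1} = 0` defines a finite set of lines through `o`. -/
def ChartR11 : Prop :=
  zdim {z : Fin (M + 1) → ℂ | z j = 0 ∧ ∀ i ∈ Finset.Icc 1 (M - 1),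
    MvPolynomial.eval z (chartComp i G v j) = 0} ≤ 1

/-- Condition (R1.2) at a non-singular point: the quadratic form `q₂` restricted to
the tangent hyperplane `{q₁ = 0}` has rank at least 6, and the linear span of every
irreducible component of `{q₁ = q₂ = q₃ = 0}` is the tangent hyperplane `{q₁ = 0}`. -/
def ChartR12 : Prop :=
  6 ≤ rankOn (chartComp 2 G v j)
        {z : Fin (M + 1) → ℂ | z j = 0 ∧ MvPolynomial.eval z (chartComp 1 G v j) = 0} ∧
  ∀ C : Set (Fin (M + 1) → ℂ),
    IsIrredCompOf C {z : Fin (M + 1) → ℂ | z j = 0 ∧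
        MvPolynomial.eval z (chartComp 1 G v j) = 0 ∧
        MvPolynomial.eval z (chartComp 2 G v j) = 0 ∧
        MvPolynomial.eval z (chartComp 3 G v j) = 0} →
      (Submodule.span ℂ C : Set (Fin (M + 1) → ℂ))
        = {z : Fin (M + 1) → ℂ | z j = 0 ∧ MvPolynomial.eval z (chartComp 1 G v j) = 0}

/-- Condition (R1.3) at a non-singular point: for every hyperplane `P ∋ o` different
from the tangent hyperplane `T_oF`, the scheme-theoretic intersection of `P`, `T_oF`,
the quadric `{q₂ = 0}` and `F` is an irreducible and reduced cycle; i.e. the ideal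
generated by the corresponding local equations is prime. -/
def ChartR13 : Prop :=
  ∀ p : MvPolynomial (Fin (M + 1)) ℂ, p.IsHomogeneous 1 →
    p ∉ Submodule.span ℂ ({chartComp 1 G v j, MvPolynomial.X j} :
      Set (MvPolynomial (Fin (M + 1)) ℂ)) →
    (Ideal.span ({MvPolynomial.X j, p, chartComp 1 G v j, chartComp 2 G v j,
        chartShift G v j} : Set (MvPolynomial (Fin (M + 1)) ℂ))).IsPrime

/-- Condition (R2.1) at a singular point `o = v` of `F = {G = 0}` (chart `z_j = 1`):
for every linear subspace `Π` of the chart of codimension `c ∈ {0,1,2}`, the sequence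
`q₂|_Π, …, q_{M−c}|_Π` is regular, i.e. its zero set in `ℙ(Π)` is finite. -/
def ChartR21 : Prop :=
  ∀ c ∈ ({0, 1, 2} : Set ℕ), ∀ Pl : Submodule ℂ (Fin (M + 1) → ℂ),
    Pl ≤ LinearMap.ker (LinearMap.proj (R := ℂ) (φ := fun _ : Fin (M + 1) => ℂ) j) →
    Module.finrank ℂ ↥Pl = M - c →
      zdim {z : Fin (M + 1) → ℂ | z ∈ Pl ∧ ∀ i ∈ Finset.Icc 2 (M - c),
        MvPolynomial.eval z (chartComp i G v j) = 0} ≤ 1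

/-- Condition (R2.2) at a singular point: the quadratic form `q₂` has rank ≥ 8. -/
def ChartR22 : Prop :=
  8 ≤ rankOn (chartComp 2 G v j) {z : Fin (M + 1) → ℂ | z j = 0}

/-- Condition (R2.3) at a singular point: the divisor `{q₃|_{q₂=0} = 0}` on the
quadric `{q₂ = 0} ⊂ ℙ^{M−1}` is not a sum of three hyperplane sections of the quadric
from the same linear pencil; i.e. there is no identity `q₃ = l₁l₂l₃ + l·q₂` with the
linear forms `l₁, l₂, l₃` lying in a pencil. -/
def ChartR23 : Prop :=
  ¬ ∃ a b l l₁ l₂ l₃ : MvPolynomial (Fin (M + 1)) ℂ,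
      a.IsHomogeneous 1 ∧ b.IsHomogeneous 1 ∧ l.IsHomogeneous 1 ∧
      l₁ ∈ Submodule.span ℂ ({a, b} : Set (MvPolynomial (Fin (M + 1)) ℂ)) ∧
      l₂ ∈ Submodule.span ℂ ({a, b} : Set (MvPolynomial (Fin (M + 1)) ℂ)) ∧
      l₃ ∈ Submodule.span ℂ ({a, b} : Set (MvPolynomial (Fin (M + 1)) ℂ)) ∧
      chartComp 3 G v j = l₁ * l₂ * l₃ + l * chartComp 2 G v j

end RegularityConditions

/-- A hypersurface `F = {G = 0}` of degree `M` in `ℙ^M` is regular (`F ∈ ℱ_reg`) if it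
satisfies conditions (R1.1)–(R1.3) at every non-singular point and conditions
(R2.1)–(R2.3) at every singular point. -/
def FRegular {M : ℕ} (G : MvPolynomial (Fin (M + 1)) ℂ) : Prop :=
  ∀ (v : Fin (M + 1) → ℂ) (j : Fin (M + 1)), v j = 1 → MvPolynomial.eval v G = 0 →
    (chartComp 1 G v j ≠ 0 → ChartR11 G v j ∧ ChartR12 G v j ∧ ChartR13 G v j) ∧
    (chartComp 1 G v j = 0 → ChartR21 G v j ∧ ChartR22 G v j ∧ ChartR23 G v j)

section ZariskiDimension

open TopologicalSpace

theorem isIrreducible_of_image {X Y : Type*} [TopologicalSpace X] [TopologicalSpace Y]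
    {f : Y → X} (hf : Topology.IsInducing f) {s : Set Y} (hs : IsIrreducible (f '' s)) :
    IsIrreducible s := by
  refine ⟨Set.image_nonempty.mp hs.1, fun u v hu hv hsu hsv => ?_⟩
  obtain ⟨u, hu', rfl⟩ := hf.isOpen_iff.mp hu
  obtain ⟨v, hv', rfl⟩ := hf.isOpen_iff.mp hv
  obtain ⟨y, hys, hyu⟩ := hsu
  obtain ⟨z, hzs, hzv⟩ := hsv
  obtain ⟨_, ⟨w, hw, rfl⟩, hwu⟩ := hs.2 u v hu' hv' ⟨f y, ⟨y, hys, rfl⟩, hyu⟩ ⟨f z, ⟨z, hzs, rfl⟩, hzv⟩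
  exact ⟨w, hw, hwu⟩

theorem zariskiTopology_eq_induced (n : ℕ) :
    zariskiTopology (Fin n → ℂ) =
      TopologicalSpace.induced (pointToPoint (k := ℂ)) PrimeSpectrum.zariskiTopology := by
  apply le_antisymm
  · rintro U ⟨V, hV, rfl⟩
    refine TopologicalSpace.isOpen_generateFrom_of_mem ?_
    obtain ⟨s, hs⟩ := (PrimeSpectrum.isOpen_iff V).mp hV
    refine ⟨(fun p v => eval v p) '' s, ?_, ?_⟩
    · rintro _ ⟨p, -, rfl⟩
      exact ⟨n, LinearMap.id, p, fun v => rfl⟩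
    · ext v
      rw [← Set.preimage_compl, hs]
      simp [PrimeSpectrum.mem_zeroLocus, pointToPoint, Set.subset_def, aeval_eq_eval]
  · refine le_generateFrom ?_
    rintro U ⟨S, hS, hU⟩
    choose! d φ p hp using hS
    let P : ((Fin n → ℂ) → ℂ) → MvPolynomial (Fin n) ℂ := fun g =>
      bind₁ (fun i => ∑ s, C (φ g (Pi.single s 1) i) * X s) (p g)
    have hP : ∀ g ∈ S, ∀ v, eval v (P g) = g v := by
      intro g hg v
      rw [hp g hg v]
      simp only [P, ← aeval_eq_eval, aeval_bind₁]
      congr 2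
      ext i
      conv_rhs => rw [LinearMap.pi_apply_eq_sum_univ (φ g) v]
      have h1 : ∀ x : Fin n, (Pi.single x 1 : Fin n → ℂ) = fun j => if x = j then 1 else 0 := by
        intro x
        funext j
        simp [Pi.single_apply, eq_comm]
      simp [mul_comm, h1]
    refine ⟨(PrimeSpectrum.zeroLocus (P '' S))ᶜ, (PrimeSpectrum.isClosed_zeroLocus _).isOpen_compl, ?_⟩
    rw [Set.preimage_compl, compl_eq_comm, hU]
    ext v
    simp +contextual [PrimeSpectrum.mem_zeroLocus, pointToPoint, Set.subset_def, aeval_eq_eval, hP]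

theorem ringKrullDim_quotient_le_zdim {n : ℕ} (J : Ideal (MvPolynomial (Fin n) ℂ)) :
    ringKrullDim (MvPolynomial (Fin n) ℂ ⧸ J) ≤ zdim (MvPolynomial.zeroLocus ℂ J) := by
  let Z := MvPolynomial.zeroLocus ℂ J
  let f : Z → PrimeSpectrum (MvPolynomial (Fin n) ℂ) := fun z => pointToPoint z.1
  let τ : TopologicalSpace Z := TopologicalSpace.induced Subtype.val (zariskiTopology (Fin n → ℂ))
  have hf : Topology.IsInducing f := by
    refine ⟨?_⟩
    change TopologicalSpace.induced Subtype.val (zariskiTopology (Fin n → ℂ)) = _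
    rw [zariskiTopology_eq_induced, induced_compose]
    rfl
  let c : PrimeSpectrum (MvPolynomial (Fin n) ℂ ⧸ J) → Ideal (MvPolynomial (Fin n) ℂ) :=
    fun P => P.asIdeal.comap (Ideal.Quotient.mk J)
  have hc : ∀ P, J ≤ c P := fun P x hx => by
    simp [c, Ideal.Quotient.eq_zero_iff_mem.mpr hx]
  have himg : ∀ P, f '' {z : Z | z.1 ∈ MvPolynomial.zeroLocus ℂ (c P)} =
      pointToPoint '' MvPolynomial.zeroLocus ℂ (c P) := by
    intro P
    ext x
    constructor
    · rintro ⟨z, hz, rfl⟩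
      exact ⟨z.1, hz, rfl⟩
    · rintro ⟨z, hz, rfl⟩
      exact ⟨⟨z, zeroLocus_anti_mono (hc P) hz⟩, hz, rfl⟩
  have hprime : ∀ P, (c P).IsPrime := fun P => Ideal.IsPrime.comap _
  have hirr : ∀ P, IsIrreducible {z : Z | z.1 ∈ MvPolynomial.zeroLocus ℂ (c P)} := by
    intro P
    have := hprime P
    refine isIrreducible_of_image hf ?_
    rw [himg, PrimeSpectrum.isIrreducible_iff_vanishingIdeal_isPrime, vanishingIdeal_pointToPoint,
      MvPolynomial.IsPrime.vanishingIdeal_zeroLocus]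
    exact hprime P
  have hcl : ∀ P, IsClosed {z : Z | z.1 ∈ MvPolynomial.zeroLocus ℂ (c P)} := by
    intro P
    convert! (PrimeSpectrum.isClosed_zeroLocus (c P : Set (MvPolynomial (Fin n) ℂ))).preimage hf.continuous
    ext z
    simp [f, PrimeSpectrum.mem_zeroLocus, pointToPoint, Set.subset_def]
  let W : PrimeSpectrum (MvPolynomial (Fin n) ℂ ⧸ J) → IrreducibleCloseds Z :=
    fun P => ⟨_, hirr P, hcl P⟩
  have hW : ∀ P Q, W P ≤ W Q ↔
      MvPolynomial.zeroLocus ℂ (c P) ⊆ MvPolynomial.zeroLocus ℂ (c Q) := fun P Q =>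
    ⟨fun h z hz => @h ⟨z, zeroLocus_anti_mono (hc P) hz⟩ hz, fun h z hz => h hz⟩
  have hle : ∀ P Q, W P ≤ W Q ↔ Q ≤ P := by
    intro P Q
    have := hprime P
    have := hprime Q
    rw [hW]
    constructor
    · intro h x hx
      obtain ⟨x, rfl⟩ := Ideal.Quotient.mk_surjective x
      have h1 := vanishingIdeal_anti_mono (k := ℂ) h
      rw [MvPolynomial.IsPrime.vanishingIdeal_zeroLocus,
        MvPolynomial.IsPrime.vanishingIdeal_zeroLocus] at h1
      exact h1 hx
    · intro h
      exact zeroLocus_anti_mono (Ideal.comap_mono h)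
  let F : (PrimeSpectrum (MvPolynomial (Fin n) ℂ ⧸ J))ᵒᵈ → IrreducibleCloseds Z :=
    fun P => W (OrderDual.ofDual P)
  have hmono : StrictMono F := fun P Q h =>
    lt_of_le_not_ge ((hle _ _).mpr h.le) fun h' => h.not_ge ((hle _ _).mp h')
  calc ringKrullDim (MvPolynomial (Fin n) ℂ ⧸ J)
      = Order.krullDim (PrimeSpectrum (MvPolynomial (Fin n) ℂ ⧸ J))ᵒᵈ :=
        Order.krullDim_orderDual.symm
    _ ≤ Order.krullDim (IrreducibleCloseds Z) := Order.krullDim_le_of_strictMono F hmono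

theorem card_le_height_vanishingIdeal_zero (n : ℕ) :
    (n : ℕ∞) ≤ (MvPolynomial.vanishingIdeal ℂ {(0 : Fin n → ℂ)}).height := by
  have htr : ∀ x : Fin n → ℂ, (MvPolynomial.vanishingIdeal ℂ {x}).height =
      (MvPolynomial.vanishingIdeal ℂ {(0 : Fin n → ℂ)}).height := by
    intro x
    let e : MvPolynomial (Fin n) ℂ ≃ₐ[ℂ] MvPolynomial (Fin n) ℂ :=
      AlgEquiv.ofAlgHom (aeval fun i => X i + C (x i)) (aeval fun i => X i - C (x i))
        (by ext; simp [algebraMap_eq]) (by ext; simp [algebraMap_eq])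
    rw [← RingEquiv.height_comap e.toRingEquiv (MvPolynomial.vanishingIdeal ℂ {0})]
    congr 1
    ext p
    have : (aeval (0 : Fin n → ℂ)).comp (aeval fun i => X i + C (x i)) =
        (aeval x : MvPolynomial (Fin n) ℂ →ₐ[ℂ] ℂ) := by ext; simp
    have h1 := congrArg (· = 0) (AlgHom.congr_fun this p)
    simp only [Ideal.mem_comap, mem_vanishingIdeal_singleton_iff]
    exact (iff_of_eq h1).symm
  have h := (MvPolynomial.ringKrullDim_of_isNoetherianRing (R := ℂ) (ι := Fin n)).symm.le.trans
    ((ringKrullDim_le_iff_isMaximal_height_le _).mpr fun m hm => by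
      obtain ⟨x, rfl⟩ := eq_vanishingIdeal_singleton_of_isMaximal ℂ hm
      exact (congrArg _ (htr x)).le)
  rw [ringKrullDim_eq_zero_of_field, zero_add, Nat.card_fin] at h
  exact_mod_cast h

/-- `m` polynomials in `n ≥ m + 2` variables vanishing at the origin have a zero locus of
dimension at least two. -/
theorem two_le_zdim {n : ℕ} (H : Finset (MvPolynomial (Fin n) ℂ)) (h0 : ∀ h ∈ H, eval 0 h = 0)
    (hcard : H.card + 2 ≤ n) : 2 ≤ zdim {z : Fin n → ℂ | ∀ h ∈ H, eval z h = 0} := by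
  have h1 : (H : Set (MvPolynomial (Fin n) ℂ)) ⊆
      (MvPolynomial.vanishingIdeal ℂ {(0 : Fin n → ℂ)} : Ideal (MvPolynomial (Fin n) ℂ)) := by
    intro h hh
    simpa [aeval_eq_eval] using h0 h hh
  have h2 := Ideal.height_le_ringKrullDim_quotient_add_encard _ h1
  have h3 := ringKrullDim_quotient_le_zdim (Ideal.span (H : Set (MvPolynomial (Fin n) ℂ)))
  rw [MvPolynomial.zeroLocus_span] at h3
  simp only [aeval_eq_eval, Finset.mem_coe] at h3
  refine le_trans ?_ h3
  have h4 : (n : WithBot ℕ∞) ≤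
      ringKrullDim (MvPolynomial (Fin n) ℂ ⧸ Ideal.span (H : Set (MvPolynomial (Fin n) ℂ))) +
        (H.card : ℕ) := by
    refine le_trans ?_ (h2.trans (by simp))
    exact_mod_cast card_le_height_vanishingIdeal_zero n
  generalize ringKrullDim (MvPolynomial (Fin n) ℂ ⧸ Ideal.span (H : Set (MvPolynomial (Fin n) ℂ)))
    = d at h4
  have h5 : ((2 + H.card : ℕ) : WithBot ℕ∞) ≤ d + (H.card : ℕ) :=
    le_trans (by exact_mod_cast (by omega : 2 + H.card ≤ n)) h4
  induction d with
  | bot => simp at h5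
  | coe d =>
    induction d with
    | top => exact le_top
    | coe d =>
      change _ ≤ ((d : ℕ) : WithBot ℕ∞) + _ at h5
      have h6 : 2 + H.card ≤ d + H.card := by exact_mod_cast h5
      change ((2 : ℕ) : WithBot ℕ∞) ≤ ((d : ℕ) : WithBot ℕ∞)
      exact_mod_cast (by omega : 2 ≤ d)

end ZariskiDimension

section Cones

variable {σ : Type*}

theorem eval_smul_of_isHomogeneous {f : MvPolynomial σ ℂ} {n : ℕ} (hf : f.IsHomogeneous n)
    (c : ℂ) (z : σ → ℂ) : eval (c • z) f = c ^ n * eval z f := by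
  rw [eval_eq, eval_eq, Finset.mul_sum]
  refine Finset.sum_congr rfl fun d hd => ?_
  have h := hf.degree_eq_sum_deg_support hd
  simp only [Pi.smul_apply, smul_eq_mul, mul_pow, Finset.prod_mul_distrib, Finset.prod_pow_eq_pow_sum]
  rw [h, ← Finsupp.degree_apply]
  ring

theorem sum_homogeneousComponent_of_totalDegree_le {f : MvPolynomial σ ℂ} {d : ℕ}
    (hd : f.totalDegree ≤ d) : ∑ k ∈ Finset.range (d + 1), homogeneousComponent k f = f := by
  conv_rhs => rw [← sum_homogeneousComponent f]
  refine (Finset.sum_subset (by simpa using hd) fun k _ hk => ?_).symm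
  exact homogeneousComponent_eq_zero _ _ (by simpa using hk)

theorem eval_smul_eq_sum {f : MvPolynomial σ ℂ} {d : ℕ} (hd : f.totalDegree ≤ d) (c : ℂ)
    (z : σ → ℂ) : eval (c • z) f =
      ∑ k ∈ Finset.range (d + 1), c ^ k * eval z (homogeneousComponent k f) := by
  conv_lhs => rw [← sum_homogeneousComponent_of_totalDegree_le hd, map_sum]
  exact Finset.sum_congr rfl fun k _ =>
    eval_smul_of_isHomogeneous (homogeneousComponent_isHomogeneous k f) c z

theorem eval_zero_homogeneousComponent (f : MvPolynomial σ ℂ) {k : ℕ} (hk : k ≠ 0) :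
    eval 0 (homogeneousComponent k f) = 0 := by
  have := eval_smul_of_isHomogeneous (homogeneousComponent_isHomogeneous k f) 0 0
  rwa [zero_smul, zero_pow hk, zero_mul] at this

theorem totalDegree_aeval_le {τ : Type*} (g : σ → MvPolynomial τ ℂ) (hg : ∀ i, (g i).totalDegree ≤ 1)
    (f : MvPolynomial σ ℂ) : (aeval g f).totalDegree ≤ f.totalDegree := by
  rw [aeval_def, eval₂_eq]
  refine totalDegree_finsetSum_le fun d hd => ?_
  refine (totalDegree_mul _ _).trans ?_
  rw [algebraMap_eq, totalDegree_C, zero_add]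
  refine (totalDegree_finsetProd _ _).trans ?_
  refine le_trans (Finset.sum_le_sum fun i _ => ?_) (le_totalDegree hd)
  exact (totalDegree_pow _ _).trans ((Nat.mul_le_mul_left _ (hg i)).trans (mul_one _).le)

/-- A polynomial of degree at most `d` vanishing at `p` vanishes on the lines through `p`
cut out by `d` forms in the direction. -/
theorem exists_finset_lines {f : MvPolynomial σ ℂ} {d : ℕ} (hd : f.totalDegree ≤ d)
    {p : σ → ℂ} (hp : eval p f = 0) :
    ∃ H : Finset (MvPolynomial σ ℂ), H.card ≤ d ∧ (∀ h ∈ H, eval 0 h = 0) ∧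
      ∀ z, (∀ h ∈ H, eval z h = 0) → ∀ c : ℂ, eval (p + c • z) f = 0 := by
  classical
  let g : MvPolynomial σ ℂ := aeval (fun i => X i + C (p i)) f
  have hg : ∀ z, eval z g = eval (p + z) f := fun z => by
    rw [← aeval_eq_eval, ← aeval_eq_eval, ← AlgHom.comp_apply]
    congr 1
    ext i
    simp [add_comm]
  have hgd : g.totalDegree ≤ d := (totalDegree_aeval_le _ (fun i => by
    refine (totalDegree_add _ _).trans ?_
    simp) f).trans hd
  refine ⟨(Finset.Icc 1 d).image fun k => homogeneousComponent k g,
    Finset.card_image_le.trans (by simp), fun h hh => ?_, fun z hz c => ?_⟩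
  · obtain ⟨k, hk, rfl⟩ := Finset.mem_image.mp hh
    exact eval_zero_homogeneousComponent g (by have := (Finset.mem_Icc.mp hk).1; omega)
  · rw [← hg, eval_smul_eq_sum hgd]
    refine Finset.sum_eq_zero fun k hk => ?_
    rcases Nat.eq_zero_or_pos k with rfl | hk0
    · have h0 : eval 0 g = 0 := by rw [hg, add_zero, hp]
      have h1 : eval z (homogeneousComponent 0 g) = 0 := by
        rw [homogeneousComponent_zero, eval_C]
        have := h0
        rwa [eval_zero, constantCoeff_eq] at this
      rw [h1, mul_zero]
    · rw [hz _ (Finset.mem_image_of_mem _ (Finset.mem_Icc.mpr ⟨hk0, by simpa [Nat.lt_succ_iff] using hk⟩)),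
        mul_zero]

theorem homogeneousComponent_mul (a b : MvPolynomial σ ℂ) (n : ℕ) :
    homogeneousComponent n (a * b) = ∑ x ∈ Finset.HasAntidiagonal.antidiagonal n,
      homogeneousComponent x.1 a * homogeneousComponent x.2 b := by
  classical
  set N := a.totalDegree + b.totalDegree + n with hN
  have ha := sum_homogeneousComponent_of_totalDegree_le (f := a) (d := N) (by omega)
  have hb := sum_homogeneousComponent_of_totalDegree_le (f := b) (d := N) (by omega)
  conv_lhs => rw [← ha, ← hb, Finset.sum_mul_sum, ← Finset.sum_product', map_sum]
  have h : ∀ x : ℕ × ℕ, homogeneousComponent n (homogeneousComponent x.1 a * homogeneousComponent x.2 b)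
      = if x.1 + x.2 = n then homogeneousComponent x.1 a * homogeneousComponent x.2 b else 0 := by
    intro x
    rw [homogeneousComponent_of_mem ((homogeneousComponent_isHomogeneous x.1 a).mul
      (homogeneousComponent_isHomogeneous x.2 b))]
    simp [eq_comm]
  simp_rw [h]
  rw [← Finset.sum_filter]
  refine Finset.sum_congr ?_ fun _ _ => rfl
  ext x
  simp only [Finset.mem_filter, Finset.mem_product, Finset.mem_range, Finset.HasAntidiagonal.mem_antidiagonal]
  omega

end Cones

section PrimeModulo

variable {σ : Type*} {I : Ideal (MvPolynomial σ ℂ)}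

theorem exists_homogeneousComponent_bounds {a : MvPolynomial σ ℂ} (ha : a ∉ I) :
    ∃ s t, homogeneousComponent s a ∉ I ∧ homogeneousComponent t a ∉ I ∧
      ∀ i, homogeneousComponent i a ∉ I → s ≤ i ∧ i ≤ t := by
  classical
  let K := (Finset.range (a.totalDegree + 1)).filter fun i => homogeneousComponent i a ∉ I
  have hK : ∀ i, homogeneousComponent i a ∉ I ↔ i ∈ K := fun i => by
    simp only [K, Finset.mem_filter, Finset.mem_range, iff_and_self]
    intro h
    by_contra h'
    exact h (by rw [homogeneousComponent_eq_zero _ _ (by omega)]; exact I.zero_mem)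
  have hne : K.Nonempty := by
    by_contra h
    rw [Finset.not_nonempty_iff_eq_empty] at h
    apply ha
    rw [← sum_homogeneousComponent a]
    refine I.sum_mem fun i _ => ?_
    by_contra hi
    simpa [h] using (hK i).mp hi
  refine ⟨K.min' hne, K.max' hne, (hK _).mpr (K.min'_mem hne), (hK _).mpr (K.max'_mem hne),
    fun i hi => ⟨K.min'_le _ ((hK i).mp hi), K.le_max' _ ((hK i).mp hi)⟩⟩

theorem homogeneousComponent_mul_notMem [hI : I.IsPrime] {a b : MvPolynomial σ ℂ} {s t : ℕ}
    (hs : homogeneousComponent s a ∉ I) (ht : homogeneousComponent t b ∉ I)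
    (h : ∀ i j, i + j = s + t → (i, j) ≠ (s, t) →
      homogeneousComponent i a ∈ I ∨ homogeneousComponent j b ∈ I) :
    homogeneousComponent (s + t) (a * b) ∉ I := by
  classical
  rw [homogeneousComponent_mul, ← Finset.add_sum_erase _ _
    (Finset.HasAntidiagonal.mem_antidiagonal.mpr rfl : (s, t) ∈ _)]
  rw [Ideal.add_mem_iff_left]
  · exact fun h' => (hI.mem_or_mem h').elim hs ht
  · refine I.sum_mem fun x hx => ?_
    rw [Finset.mem_erase, Finset.HasAntidiagonal.mem_antidiagonal] at hx
    rcases h x.1 x.2 hx.2 hx.1 with h' | h'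
    · exact I.mul_mem_right _ h'
    · exact I.mul_mem_left _ h'

theorem sub_sum_Icc_mem {a : MvPolynomial σ ℂ} {s t : ℕ}
    (h : ∀ i, homogeneousComponent i a ∉ I → s ≤ i ∧ i ≤ t) :
    a - ∑ i ∈ Finset.Icc s t, homogeneousComponent i a ∈ I := by
  classical
  set N := a.totalDegree + t with hN
  have ha := sum_homogeneousComponent_of_totalDegree_le (f := a) (d := N) (by omega)
  conv => enter [2, 1]; rw [← ha]
  rw [← Finset.sum_sdiff_eq_sub fun i hi => by
    simp only [Finset.mem_Icc, Finset.mem_range] at hi ⊢; omega]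
  refine I.sum_mem fun i hi => ?_
  by_contra hi'
  have := h i hi'
  simp only [Finset.mem_sdiff, Finset.mem_Icc] at hi
  exact hi.2 this

/-- No point of `{F = 0}` is the vertex of a cone, cut out by at most `M - 4` equations in the
direction, that lies in `{F = 0}`. -/
def HasNoCone {σ : Type*} (M : ℕ) (F : MvPolynomial σ ℂ) : Prop :=
  ∀ p, eval p F = 0 → ∀ H : Finset (MvPolynomial σ ℂ), (∀ h ∈ H, eval 0 h = 0) →
    H.card + 4 ≤ M → ∃ z, (∀ h ∈ H, eval z h = 0) ∧ ∃ c : ℂ, eval (p + c • z) F ≠ 0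

/-- An element `F` of degree at most `M` whose terms of degree at most two lie in a homogeneous
prime ideal `I`, and whose zero locus contains no cone of small codimension, is not a product of
two non-units modulo `I`. -/
theorem isUnit_mk_or_isUnit_mk [Finite σ] {M : ℕ} (hM : 10 ≤ M) [hI : I.IsPrime]
    (hhom : ∀ f ∈ I, ∀ k, homogeneousComponent k f ∈ I)
    (hzero : ∀ f ∈ I, eval 0 f = 0)
    (hcone : ∀ p, (∀ f ∈ I, eval p f = 0) → ∃ H : Finset (MvPolynomial σ ℂ), H.card ≤ 2 ∧
      (∀ h ∈ H, eval 0 h = 0) ∧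
      ∀ z, (∀ h ∈ H, eval z h = 0) → ∀ c : ℂ, ∀ f ∈ I, eval (p + c • z) f = 0)
    {F : MvPolynomial σ ℂ} (hd : F.totalDegree ≤ M)
    (hlow : ∀ k < 3, homogeneousComponent k F ∈ I)
    (hline : HasNoCone M F)
    {a b : MvPolynomial σ ℂ} (hab : a * b - F ∈ I) :
    IsUnit (Ideal.Quotient.mk I a) ∨ IsUnit (Ideal.Quotient.mk I b) := by
  classical
  have hF0 : eval 0 F = 0 := by
    have := hzero _ (hlow 0 (by omega))
    rwa [homogeneousComponent_zero, eval_C, ← constantCoeff_eq, ← eval_zero] at this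
  have kill : ∀ p, (∀ f ∈ I, eval p f = 0) → ∀ a b : MvPolynomial σ ℂ, a * b - F ∈ I →
      ∀ H : Finset (MvPolynomial σ ℂ), (∀ h ∈ H, eval 0 h = 0) →
      (∀ z, (∀ h ∈ H, eval z h = 0) → ∀ c : ℂ, eval (p + c • z) a = 0) → M < H.card + 6 := by
    intro p hp a b hab H hH0 hH
    by_contra! hcard
    obtain ⟨H', hH'c, hH'0, hH'⟩ := hcone p hp
    have hva : ∀ z, (∀ f ∈ I, eval z f = 0) → eval z a = 0 → eval z F = 0 := by
      intro z hz hza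
      have := hz _ hab
      rw [map_sub, map_mul, hza, zero_mul, zero_sub, neg_eq_zero] at this
      exact this
    have hpF : eval p F = 0 := by
      refine hva p hp ?_
      have := hH 0 hH0 0
      rwa [zero_smul, add_zero] at this
    obtain ⟨z, hz, c, hc⟩ := hline p hpF (H ∪ H')
      (fun h hh => (Finset.mem_union.mp hh).elim (hH0 h) (hH'0 h))
      (by have := Finset.card_union_le H H'; omega)
    refine hc (hva _ (fun f hf => hH' z (fun h hh => hz h (Finset.mem_union_right _ hh)) c f hf)
      (hH z (fun h hh => hz h (Finset.mem_union_left _ hh)) c))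
  have hFI : F ∉ I := by
    intro hFI
    have := kill 0 hzero 0 0 (by simpa using hFI) ∅ (by simp) (by simp)
    simp at this
    omega
  have habI : a * b ∉ I := fun h => hFI (by simpa using I.sub_mem h hab)
  have haI : a ∉ I := fun h => habI (I.mul_mem_right _ h)
  have hbI : b ∉ I := fun h => habI (I.mul_mem_left _ h)
  obtain ⟨s, S, hs, hS, hsS⟩ := exists_homogeneousComponent_bounds haI
  obtain ⟨t, T, ht, hT, htT⟩ := exists_homogeneousComponent_bounds hbI
  have hcomp : ∀ n, homogeneousComponent n (a * b) ∉ I → homogeneousComponent n F ∉ I := by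
    intro n hn hF
    refine hn ?_
    have := I.add_mem (hhom _ hab n) hF
    rwa [← map_add, sub_add_cancel] at this
  have hst : 3 ≤ s + t := by
    by_contra! h
    refine hcomp _ (homogeneousComponent_mul_notMem hs ht fun i j hij hne => ?_) (hlow _ h)
    by_contra! h'
    have h1 := (hsS i h'.1).1
    have h2 := (htT j h'.2).1
    exact hne (Prod.ext (by simp; omega) (by simp; omega))
  have hST : S + T ≤ M := by
    by_contra! h
    refine hcomp _ (homogeneousComponent_mul_notMem hS hT fun i j hij hne => ?_)
      (by rw [homogeneousComponent_eq_zero _ _ (by omega)]; exact I.zero_mem)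
    by_contra! h'
    have h1 := (hsS i h'.1).2
    have h2 := (htT j h'.2).2
    exact hne (Prod.ext (by simp; omega) (by simp; omega))
  have htrunc : ∀ {a b : MvPolynomial σ ℂ} {s S : ℕ}, a * b - F ∈ I →
      (∀ i, homogeneousComponent i a ∉ I → s ≤ i ∧ i ≤ S) →
      (∑ i ∈ Finset.Icc s S, homogeneousComponent i a) * b - F ∈ I := by
    intro a b s S hab h
    have h1 := I.mul_mem_right b (sub_sum_Icc_mem h)
    have h2 := I.sub_mem hab h1
    convert! h2 using 1
    ring
  have hpos : ∀ {a b : MvPolynomial σ ℂ} {s S : ℕ}, a * b - F ∈ I → 1 ≤ s →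
      (∀ i, homogeneousComponent i a ∉ I → s ≤ i ∧ i ≤ S) → M < (S + 1 - s) + 6 := by
    intro a b s S hab hs h
    have := kill 0 hzero _ b (htrunc hab h)
      ((Finset.Icc s S).image fun i => homogeneousComponent i a)
      (fun h hh => by
        obtain ⟨k, hk, rfl⟩ := Finset.mem_image.mp hh
        exact eval_zero_homogeneousComponent a (by have := (Finset.mem_Icc.mp hk).1; omega))
      (fun z hz c => by
        rw [map_sum]
        refine Finset.sum_eq_zero fun i hi => ?_
        rw [zero_add, eval_smul_of_isHomogeneous (homogeneousComponent_isHomogeneous i a),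
          hz _ (Finset.mem_image_of_mem _ hi), mul_zero])
    refine this.trans_le ?_
    have := Finset.card_image_le (s := Finset.Icc s S) (f := fun i => homogeneousComponent i a)
    rw [Nat.card_Icc] at this
    omega
  have hunit : ∀ {a b : MvPolynomial σ ℂ} {S : ℕ}, a * b - F ∈ I →
      (∀ i, homogeneousComponent i a ∉ I → 0 ≤ i ∧ i ≤ S) → S ≤ 3 →
      IsUnit (Ideal.Quotient.mk I a) := by
    intro a b S hab h hS
    by_contra hu
    have hne : I ⊔ Ideal.span {a} ≠ ⊤ := by
      intro htop
      rw [Ideal.eq_top_iff_one, Submodule.mem_sup] at htop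
      obtain ⟨y, hy, w, hw, hyw⟩ := htop
      obtain ⟨w, rfl⟩ := Ideal.mem_span_singleton'.mp hw
      apply hu
      refine IsUnit.of_mul_eq_one (Ideal.Quotient.mk I w) ?_
      rw [← map_mul, ← map_one (Ideal.Quotient.mk I), Ideal.Quotient.eq, ← hyw]
      convert! I.neg_mem hy using 1
      ring
    obtain ⟨m, hm, hle⟩ := Ideal.exists_le_maximal _ hne
    obtain ⟨p, rfl⟩ := eq_vanishingIdeal_singleton_of_isMaximal ℂ hm
    have hmem : ∀ f ∈ I ⊔ Ideal.span {a}, eval p f = 0 := fun f hf => by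
      have := hle hf
      rwa [mem_vanishingIdeal_singleton_iff, aeval_eq_eval] at this
    have hpI : ∀ f ∈ I, eval p f = 0 := fun f hf => hmem f (Ideal.mem_sup_left hf)
    have hpa : eval p (∑ i ∈ Finset.Icc 0 S, homogeneousComponent i a) = 0 := by
      have h1 := hpI _ (sub_sum_Icc_mem h)
      rw [map_sub, hmem a (Ideal.mem_sup_right (Ideal.mem_span_singleton_self a)), zero_sub,
        neg_eq_zero] at h1
      exact h1
    obtain ⟨H, hHc, hH0, hH⟩ := exists_finset_lines (d := S) (totalDegree_finsetSum_le fun i hi =>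
      ((homogeneousComponent_isHomogeneous i a).totalDegree_le).trans (Finset.mem_Icc.mp hi).2) hpa
    have := kill p hpI _ b (htrunc hab h) H hH0 hH
    omega
  rcases Nat.eq_zero_or_pos s with rfl | hs0
  · left
    refine hunit hab hsS ?_
    have := hpos (a := b) (b := a) (by rwa [mul_comm]) (by omega) htT
    omega
  rcases Nat.eq_zero_or_pos t with rfl | ht0
  · right
    refine hunit (a := b) (b := a) (by rwa [mul_comm]) htT ?_
    have := hpos hab (by omega) hsS
    omega
  · have h1 := hpos (a := b) (b := a) (by rwa [mul_comm]) ht0 htT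
    have h2 := hpos hab hs0 hsS
    omega

end PrimeModulo

section NagataQuadric

theorem sub_aeval_mem {σ : Type*} {J : Ideal (MvPolynomial σ ℂ)} (g : σ → MvPolynomial σ ℂ)
    (h : ∀ i, X i - g i ∈ J) (s : MvPolynomial σ ℂ) : s - aeval g s ∈ J := by
  rw [← Ideal.Quotient.eq]
  have : Ideal.Quotient.mkₐ ℂ J = (Ideal.Quotient.mkₐ ℂ J).comp (aeval g) := by
    ext i
    simpa using Ideal.Quotient.eq.mpr (h i)
  exact AlgHom.congr_fun this s

theorem notMem_vars_rename {σ τ : Type*} (e : σ → τ) (p : MvPolynomial σ ℂ) {i : τ}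
    (hi : i ∉ Set.range e) : i ∉ (rename e p).vars := by
  classical
  intro h
  obtain ⟨j, -, hj⟩ := mem_vars_rename e p h
  exact hi ⟨j, hj⟩

theorem uniqueFactorizationMonoid_of_prime_of_exists_pow_mul {A B : Type*} [CommRing A] [IsDomain A]
    [IsNoetherianRing A] [CommRing B] [IsDomain B] [UniqueFactorizationMonoid B] (f : B →+* A)
    (hf : Function.Injective f) (x : B) (hx : Prime (f x))
    (h : ∀ a, ∃ (k : ℕ) (b : B), f x ^ k * a = f b) : UniqueFactorizationMonoid A := by
  rw [UniqueFactorizationMonoid.iff_localizationAway_of_prime hx]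
  let L := Localization.Away (f x)
  let _ : Algebra B L := ((algebraMap A L).comp f).toAlgebra
  have hinj : Function.Injective (algebraMap A L) :=
    IsLocalization.injective L (powers_le_nonZeroDivisors_of_noZeroDivisors hx.ne_zero)
  have hx0 : x ≠ 0 := fun h0 => hx.ne_zero (by rw [h0, map_zero])
  have hmap : ∀ b, algebraMap B L b = algebraMap A L (f b) := fun b => rfl
  have hloc : IsLocalization (Submonoid.powers x) L := by
    refine ⟨?_, ?_, ?_⟩
    · rintro ⟨_, n, rfl⟩
      simp only [hmap, map_pow]
      exact (IsLocalization.Away.algebraMap_isUnit (f x)).pow n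
    · intro z
      obtain ⟨n, a, ha⟩ := IsLocalization.Away.surj (f x) z
      obtain ⟨k, b, hb⟩ := h a
      refine ⟨⟨b, ⟨x ^ (n + k), n + k, rfl⟩⟩, ?_⟩
      simp only [hmap, map_pow]
      rw [← hb, map_mul, map_pow, ← ha]
      ring
    · intro b c hbc
      exact ⟨1, by rw [hf (hinj hbc)]⟩
  exact UniqueFactorizationMonoid.of_isLocalization (Submonoid.powers x) L

theorem isPrime_span_pair_of_prime_mk {A : Type*} [CommRing A] {q F : A}
    (h : Prime (Ideal.Quotient.mk (Ideal.span {q}) F)) : (Ideal.span {q, F}).IsPrime := by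
  have h1 := ((Ideal.span_singleton_prime h.ne_zero).mpr h)
  have h2 : Ideal.span {q, F} = (Ideal.span {Ideal.Quotient.mk (Ideal.span {q}) F}).comap
      (Ideal.Quotient.mk (Ideal.span {q})) := by
    rw [← Set.image_singleton, ← Ideal.map_span,
      Ideal.comap_map_of_surjective' _ Ideal.Quotient.mk_surjective, Ideal.mk_ker, sup_comm,
      ← Ideal.span_union, Set.singleton_union]
  rw [h2]
  exact Ideal.IsPrime.comap _

variable {κ : Type*} [Fintype κ]

/-- The form `zw - ∑ cₖ uₖ²`. -/
def quadricTail (c : κ → ℂ) : MvPolynomial (Fin 4 ⊕ κ) ℂ :=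
  X (Sum.inl 2) * X (Sum.inl 3) - ∑ k, C (c k) * X (Sum.inr k) ^ 2

/-- The quadratic form `xy - (zw - ∑ cₖ uₖ²)`. -/
def quadric (c : κ → ℂ) : MvPolynomial (Fin 4 ⊕ κ) ℂ :=
  X (Sum.inl 0) * X (Sum.inl 1) - quadricTail c

theorem not_X_dvd_of_eval_ne_zero {σ : Type*} {i : σ} {p : MvPolynomial σ ℂ} (v : σ → ℂ)
    (hv : v i = 0) (hp : eval v p ≠ 0) : ¬ X i ∣ p := by
  rintro ⟨r, rfl⟩
  simp [hv] at hp

theorem exists_rename_eq_quadricTail (c : κ → ℂ) :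
    ∃ p : MvPolynomial {i : Fin 4 ⊕ κ // i ≠ Sum.inl 0 ∧ i ≠ Sum.inl 1} ℂ,
      rename Subtype.val p = quadricTail c :=
  ⟨X ⟨Sum.inl 2, by simp⟩ * X ⟨Sum.inl 3, by simp⟩ -
    ∑ k, C (c k) * X (⟨Sum.inr k, by simp⟩ : {i : Fin 4 ⊕ κ // i ≠ Sum.inl 0 ∧ i ≠ Sum.inl 1}) ^ 2,
    by simp [quadricTail]⟩

theorem irreducible_quadric (c : κ → ℂ) : Irreducible (quadric c) := by
  have hdvd : ¬ X (Sum.inl 0) ∣ -quadricTail c :=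
    not_X_dvd_of_eval_ne_zero (Sum.elim ![0, 0, 1, 1] 0) (by simp) (by simp [quadricTail])
  rw [quadric, sub_eq_add_neg]
  refine irreducible_mul_X_add _ _ _ (X_ne_zero _) (by simp [vars_X]) ?_
    ((X_prime (i := Sum.inl 0)).irreducible.isRelPrime_iff_not_dvd.mpr hdvd)
  obtain ⟨p, hp⟩ := exists_rename_eq_quadricTail c
  rw [← hp, ← map_neg]
  exact notMem_vars_rename _ _ (by simp)

theorem irreducible_quadricTail {c : κ → ℂ} (hc : c ≠ 0) : Irreducible (quadricTail c) := by
  classical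
  obtain ⟨k, hk⟩ := Function.ne_iff.mp hc
  have hk' : c k ≠ 0 := hk
  have hdvd : ¬ (X (Sum.inl 2) : MvPolynomial (Fin 4 ⊕ κ) ℂ) ∣
      rename Sum.inr (-∑ k, C (c k) * X k ^ 2) :=
    not_X_dvd_of_eval_ne_zero (Sum.elim 0 (Pi.single k 1)) (by simp)
      (by simp [Pi.single_apply, hk'])
  have h : quadricTail c = X (Sum.inl 2) * X (Sum.inl 3) +
      rename Sum.inr (-∑ k, C (c k) * X k ^ 2) := by
    simp [quadricTail, sub_eq_add_neg]
  rw [h]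
  exact irreducible_mul_X_add _ _ _ (X_ne_zero _) (by simp [vars_X]) (notMem_vars_rename _ _ (by simp))
    ((X_prime (i := Sum.inl 2)).irreducible.isRelPrime_iff_not_dvd.mpr hdvd)

instance isPrime_span_quadric (c : κ → ℂ) : (Ideal.span {quadric c}).IsPrime :=
  (Ideal.span_singleton_prime (irreducible_quadric c).ne_zero).mpr (irreducible_quadric c).prime

theorem prime_mk_X_quadric {c : κ → ℂ} (hc : c ≠ 0) :
    Prime (Ideal.Quotient.mk (Ideal.span {quadric c}) (X (Sum.inl 0))) := by
  classical
  set q := quadric c with hq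
  set h := quadricTail c with hh
  let θ : MvPolynomial (Fin 4 ⊕ κ) ℂ →ₐ[ℂ] MvPolynomial (Fin 4 ⊕ κ) ℂ :=
    aeval fun i => if i = Sum.inl 0 then 0 else X i
  have hθx : θ (X (Sum.inl 0)) = 0 := by simp [θ]
  have hθh : θ h = h := by simp [θ, hh, quadricTail]
  have hθq : θ q = -h := by rw [hq, quadric, map_sub, map_mul, hθx, zero_mul, zero_sub, ← hh, hθh]
  have hspan : Ideal.span {X (Sum.inl 0), q} = (Ideal.span {h}).comap θ := by
    apply le_antisymm
    · rw [Ideal.span_le]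
      rintro _ (rfl | rfl)
      · simp [hθx]
      · simp [hθq]
    · intro s hs
      obtain ⟨r, hr⟩ := Ideal.mem_span_singleton'.mp (Ideal.mem_comap.mp hs)
      have h1 : s - θ s ∈ Ideal.span {X (Sum.inl 0), q} := by
        refine sub_aeval_mem _ (fun i => ?_) s
        split_ifs with hi
        · rw [hi, sub_zero]
          exact Ideal.subset_span (by simp)
        · simp
      have h2 : h ∈ Ideal.span {X (Sum.inl 0), q} := by
        refine Ideal.mem_span_pair.mpr ⟨X (Sum.inl 1), -1, ?_⟩
        simp only [hq, quadric]
        ring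
      have h3 := Ideal.add_mem _ h1 (Ideal.mul_mem_left _ r h2)
      rwa [hr, sub_add_cancel] at h3
  have hhp : (Ideal.span {h}).IsPrime :=
    (Ideal.span_singleton_prime (irreducible_quadricTail hc).ne_zero).mpr
      (irreducible_quadricTail hc).prime
  have hP : (Ideal.span {X (Sum.inl 0), q}).IsPrime := by
    rw [hspan]
    exact Ideal.IsPrime.comap _
  have hmap : (Ideal.span {X (Sum.inl 0), q}).map (Ideal.Quotient.mk (Ideal.span {q})) =
      Ideal.span {Ideal.Quotient.mk (Ideal.span {q}) (X (Sum.inl 0))} := by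
    rw [Ideal.map_span, Set.image_pair, Ideal.Quotient.mk_singleton_self, Set.pair_comm,
      Ideal.span_insert_zero]
  rw [← Ideal.span_singleton_prime, ← hmap]
  · refine Ideal.map_isPrime_of_surjective Ideal.Quotient.mk_surjective ?_
    rw [Ideal.mk_ker, Ideal.span_singleton_le_iff_mem]
    exact Ideal.subset_span (by simp)
  · intro h0
    rw [Ideal.Quotient.eq_zero_iff_mem, Ideal.mem_span_singleton] at h0
    obtain ⟨r, hr⟩ := h0
    have := congrArg (eval (Sum.elim ![1, 1, 1, 1] 0)) hr
    simp [hq, quadric, quadricTail] at this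

theorem uniqueFactorizationMonoid_quotient_quadric {c : κ → ℂ} (hc : c ≠ 0) :
    UniqueFactorizationMonoid (MvPolynomial (Fin 4 ⊕ κ) ℂ ⧸ Ideal.span {quadric c}) := by
  classical
  let τ := {i : Fin 4 ⊕ κ // i ≠ Sum.inl 1}
  let x : τ := ⟨Sum.inl 0, by simp⟩
  let I := Ideal.span {quadric c}
  let f : MvPolynomial τ ℂ →ₐ[ℂ] (MvPolynomial (Fin 4 ⊕ κ) ℂ ⧸ I) :=
    (Ideal.Quotient.mkₐ ℂ I).comp (rename Subtype.val)
  have hfx : ∀ b, f b = Ideal.Quotient.mk I (rename Subtype.val b) := fun b => rfl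
  obtain ⟨h, hh⟩ : ∃ h : MvPolynomial τ ℂ, rename Subtype.val h = quadricTail c := by
    obtain ⟨p, hp⟩ := exists_rename_eq_quadricTail c
    exact ⟨rename (fun i => ⟨i.1, i.2.2⟩) p, by rw [rename_rename, ← hp]; rfl⟩
  refine uniqueFactorizationMonoid_of_prime_of_exists_pow_mul (f : MvPolynomial τ ℂ →+* _) ?_ (X x)
    ?_ ?_
  · rw [injective_iff_map_eq_zero]
    intro b hb
    have hb' : rename Subtype.val b ∈ I := Ideal.Quotient.eq_zero_iff_mem.mp hb
    let T := FractionRing (MvPolynomial τ ℂ)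
    let χ : MvPolynomial (Fin 4 ⊕ κ) ℂ →ₐ[ℂ] T := aeval fun i =>
      if hi : i = Sum.inl 1 then algebraMap (MvPolynomial τ ℂ) T h / algebraMap (MvPolynomial τ ℂ) T (X x)
      else algebraMap (MvPolynomial τ ℂ) T (X ⟨i, hi⟩)
    have hcomp : ∀ b : MvPolynomial τ ℂ, χ (rename Subtype.val b) = algebraMap _ T b := by
      intro b
      have : χ.comp (rename Subtype.val) = Algebra.algHom ℂ (MvPolynomial τ ℂ) T := by
        ext i
        simp [χ, i.2]
        rfl
      exact AlgHom.congr_fun this b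
    have hχx : χ (X (Sum.inl 0)) = algebraMap (MvPolynomial τ ℂ) T (X x) := by simp [χ, x]
    have hχy : χ (X (Sum.inl 1)) =
        algebraMap (MvPolynomial τ ℂ) T h / algebraMap (MvPolynomial τ ℂ) T (X x) := by simp [χ]
    have hx0 : algebraMap (MvPolynomial τ ℂ) T (X x) ≠ 0 := by
      rw [Ne, FaithfulSMul.algebraMap_eq_zero_iff]
      exact X_ne_zero _
    have hq : χ (quadric c) = 0 := by
      rw [quadric, map_sub, map_mul, hχx, hχy, mul_div_cancel₀ _ hx0, ← hh, hcomp, sub_self]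
    obtain ⟨r, hr⟩ := Ideal.mem_span_singleton'.mp hb'
    have := congrArg χ hr
    rw [map_mul, hq, mul_zero, hcomp] at this
    exact (FaithfulSMul.algebraMap_eq_zero_iff _ T).mp this.symm
  · change Prime (f (X x))
    rw [hfx, rename_X]
    exact prime_mk_X_quadric hc
  · intro a
    change ∃ (k : ℕ) (b : MvPolynomial τ ℂ), f (X x) ^ k * a = f b
    obtain ⟨s, rfl⟩ := Ideal.Quotient.mk_surjective a
    induction s using MvPolynomial.induction_on with
    | C a => exact ⟨0, C a, by rw [pow_zero, one_mul, hfx, rename_C]⟩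
    | add p q hp hq =>
      obtain ⟨k, b, hb⟩ := hp
      obtain ⟨l, d, hd⟩ := hq
      refine ⟨k + l, X x ^ l * b + X x ^ k * d, ?_⟩
      rw [map_add, map_add f, map_mul, map_mul, map_pow, map_pow, ← hb, ← hd]
      ring
    | mul_X p i hp =>
      obtain ⟨k, b, hb⟩ := hp
      by_cases hi : i = Sum.inl 1
      · refine ⟨k + 1, b * h, ?_⟩
        have h1 : f (X x) * Ideal.Quotient.mk I (X i) = f h := by
          rw [hfx, hfx, ← map_mul, Ideal.Quotient.eq, hh, rename_X, hi]
          exact Ideal.mem_span_singleton_self _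
        rw [map_mul, map_mul, ← hb, ← h1]
        ring
      · refine ⟨k, b * X ⟨i, hi⟩, ?_⟩
        rw [map_mul, map_mul, ← hb, hfx (X ⟨i, hi⟩), rename_X]
        ring

end NagataQuadric

section QuadricSections

theorem homogeneousComponent_aeval {σ τ : Type*} {g : σ → MvPolynomial τ ℂ}
    (hg : ∀ i, (g i).IsHomogeneous 1) (n : ℕ) (f : MvPolynomial σ ℂ) :
    homogeneousComponent n (aeval g f) = aeval g (homogeneousComponent n f) := by
  classical
  have hf := sum_homogeneousComponent_of_totalDegree_le (f := f) (d := f.totalDegree + n) (by omega)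
  have h : ∀ k, homogeneousComponent n (aeval g (homogeneousComponent k f)) =
      if n = k then aeval g (homogeneousComponent k f) else 0 := fun k => by
    refine homogeneousComponent_of_mem ?_
    simpa using (homogeneousComponent_isHomogeneous k f).aeval g hg
  calc _ = ∑ k ∈ Finset.range (f.totalDegree + n + 1),
        homogeneousComponent n (aeval g (homogeneousComponent k f)) := by
        rw [← map_sum, ← map_sum, hf]
    _ = _ := by
      simp_rw [h]
      rw [Finset.sum_ite_eq, if_pos (Finset.mem_range.mpr (by omega))]

theorem irreducible_of_forall_specialization {τ : Type*} {g : MvPolynomial τ (Polynomial ℂ)}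
    (hg : ¬ IsUnit g) (hg0 : ∀ t : ℂ, map (Polynomial.evalRingHom t) g ≠ 0)
    (h : ∀ (t : ℂ) (a b : MvPolynomial τ ℂ), a * b = map (Polynomial.evalRingHom t) g →
      IsUnit a ∨ IsUnit b) : Irreducible g := by
  classical
  have key : ∀ a b : MvPolynomial τ (Polynomial ℂ), g = a * b →
      {t : ℂ | IsUnit (map (Polynomial.evalRingHom t) a)}.Infinite → IsUnit a := by
    intro a b hab hinf
    have hC : a = C (coeff 0 a) := by
      ext1 d
      rw [coeff_C]
      split_ifs with hd
      · rw [hd]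
      · refine Polynomial.eq_zero_of_infinite_isRoot _ (hinf.mono fun t ht => ?_)
        have h1 := (MvPolynomial.isUnit_iff_eq_C_of_isReduced.mp ht)
        obtain ⟨r, -, hr⟩ := h1
        have h2 := congrArg (coeff d) hr
        rw [coeff_map, coeff_C, if_neg hd] at h2
        exact h2
    rw [hC]
    refine IsUnit.map _ ?_
    rw [Polynomial.isUnit_iff_degree_eq_zero]
    by_contra hdeg
    obtain ⟨t, ht⟩ := IsAlgClosed.exists_root _ hdeg
    refine hg0 t ?_
    rw [hab, map_mul, hC, map_C]
    have : Polynomial.evalRingHom t (coeff 0 a) = 0 := ht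
    rw [this, C_0, zero_mul]
  refine ⟨hg, fun a b hab => ?_⟩
  have hun : {t : ℂ | IsUnit (map (Polynomial.evalRingHom t) a)} ∪
      {t : ℂ | IsUnit (map (Polynomial.evalRingHom t) b)} = Set.univ := by
    refine Set.eq_univ_of_forall fun t => h t _ _ ?_
    rw [hab, map_mul]
  have hinf : (Set.univ : Set ℂ).Infinite := Set.infinite_univ
  rw [← hun, Set.infinite_union] at hinf
  exact hinf.imp (key a b hab) (key b a (by rw [hab, mul_comm]))

variable {κ : Type*} [Fintype κ]

theorem isHomogeneous_quadric (c : κ → ℂ) : (quadric c).IsHomogeneous 2 := by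
  refine ((isHomogeneous_X ℂ _).mul (isHomogeneous_X ℂ _)).sub
    (((isHomogeneous_X ℂ _).mul (isHomogeneous_X ℂ _)).sub (IsHomogeneous.sum _ _ _ fun k _ => ?_))
  simpa using (isHomogeneous_C _ (c k)).mul ((isHomogeneous_X ℂ (Sum.inr k)).pow 2)

theorem eval_eq_zero_of_mem_span_quadric {c : κ → ℂ} {f : MvPolynomial (Fin 4 ⊕ κ) ℂ}
    (hf : f ∈ Ideal.span {quadric c}) {z : Fin 4 ⊕ κ → ℂ} (hz : eval z (quadric c) = 0) :
    eval z f = 0 := by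
  obtain ⟨r, rfl⟩ := Ideal.mem_span_singleton'.mp hf
  rw [map_mul, hz, mul_zero]

theorem eval_zero_quadric (c : κ → ℂ) : eval 0 (quadric c) = 0 := by
  simp [quadric, quadricTail]

theorem eval_zero_eq_zero_of_low {c : κ → ℂ} {F : MvPolynomial (Fin 4 ⊕ κ) ℂ}
    (hlow : ∀ k < 3, homogeneousComponent k F ∈ Ideal.span {quadric c}) : eval 0 F = 0 := by
  have := eval_eq_zero_of_mem_span_quadric (hlow 0 (by omega)) (eval_zero_quadric c)
  rwa [homogeneousComponent_zero, eval_C, ← constantCoeff_eq, ← eval_zero] at this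

theorem isPrime_span_quadric_pair_of_ne_zero {M : ℕ} (hM : 10 ≤ M) {c : κ → ℂ} (hc : c ≠ 0)
    {F : MvPolynomial (Fin 4 ⊕ κ) ℂ} (hd : F.totalDegree ≤ M)
    (hlow : ∀ k < 3, homogeneousComponent k F ∈ Ideal.span {quadric c}) (hline : HasNoCone M F) :
    (Ideal.span {quadric c, F}).IsPrime := by
  have := uniqueFactorizationMonoid_quotient_quadric hc
  refine isPrime_span_pair_of_prime_mk (Irreducible.prime ⟨fun hu => ?_, fun a b hab => ?_⟩)
  · obtain ⟨r, hr⟩ := hu.exists_right_inv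
    obtain ⟨r, rfl⟩ := Ideal.Quotient.mk_surjective r
    rw [← map_mul, ← map_one (Ideal.Quotient.mk _), Ideal.Quotient.eq] at hr
    have := eval_eq_zero_of_mem_span_quadric hr (eval_zero_quadric c)
    rw [map_sub, map_mul, eval_zero_eq_zero_of_low hlow, map_one] at this
    simp at this
  · obtain ⟨a, rfl⟩ := Ideal.Quotient.mk_surjective a
    obtain ⟨b, rfl⟩ := Ideal.Quotient.mk_surjective b
    rw [← map_mul, eq_comm, Ideal.Quotient.eq] at hab
    refine isUnit_mk_or_isUnit_mk hM ?_ (fun f hf =>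
      eval_eq_zero_of_mem_span_quadric hf (eval_zero_quadric c)) ?_ hd hlow hline hab
    · intro f hf k
      obtain ⟨r, rfl⟩ := Ideal.mem_span_singleton'.mp hf
      rw [homogeneousComponent_mul]
      refine Ideal.sum_mem _ fun x _ => Ideal.mul_mem_left _ _ ?_
      rw [homogeneousComponent_of_mem (isHomogeneous_quadric c)]
      split_ifs
      · exact Ideal.mem_span_singleton_self _
      · exact Ideal.zero_mem _
    · intro p hp
      obtain ⟨H, hH, hH0, hHz⟩ := exists_finset_lines (isHomogeneous_quadric c).totalDegree_le
        (hp _ (Ideal.mem_span_singleton_self _))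
      exact ⟨H, hH, hH0, fun z hz t f hf => eval_eq_zero_of_mem_span_quadric hf (hHz z hz t)⟩

end QuadricSections

section SplitQuadric

variable {κ : Type*}

theorem quadric_zero [Fintype κ] : (quadric (0 : κ → ℂ)) =
    X (Sum.inl 0) * X (Sum.inl 1) - X (Sum.inl 2) * X (Sum.inl 3) := by
  simp [quadric, quadricTail]

/-- Restriction of polynomials to the linear space `{y = tz, w = tx}` in the ruling of the
quadric `xy = zw`. -/
def rulingMap (κ : Type*) (t : ℂ) :
    MvPolynomial (Fin 4 ⊕ κ) ℂ →ₐ[ℂ] MvPolynomial (Fin 2 ⊕ κ) ℂ :=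
  aeval (Sum.elim ![X (Sum.inl 0), C t * X (Sum.inl 1), X (Sum.inl 1), C t * X (Sum.inl 0)]
    fun k => X (Sum.inr k))

/-- The restriction to all the linear spaces `{y = tz, w = tx}` simultaneously. -/
def rulingFamilyMap (κ : Type*) :
    MvPolynomial (Fin 4 ⊕ κ) ℂ →ₐ[ℂ] MvPolynomial (Fin 2 ⊕ κ) (Polynomial ℂ) :=
  aeval (Sum.elim ![X (Sum.inl 0), C Polynomial.X * X (Sum.inl 1), X (Sum.inl 1),
    C Polynomial.X * X (Sum.inl 0)] fun k => X (Sum.inr k))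

theorem map_rulingFamilyMap (t : ℂ) (f : MvPolynomial (Fin 4 ⊕ κ) ℂ) :
    map (Polynomial.evalRingHom t) (rulingFamilyMap κ f) = rulingMap κ t f := by
  induction f using MvPolynomial.induction_on with
  | C a =>
    have h1 : rulingFamilyMap κ (C a) = C (Polynomial.C a) := by
      rw [rulingFamilyMap, aeval_C]
      rfl
    have h2 : rulingMap κ t (C a) = C a := by
      rw [rulingMap, aeval_C]
      rfl
    rw [h1, h2, map_C]
    simp
  | add p q hp hq => simp only [map_add, hp, hq]
  | mul_X p i hp =>
    have hi : map (Polynomial.evalRingHom t) (rulingFamilyMap κ (X i)) = rulingMap κ t (X i) := by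
      rw [rulingFamilyMap, rulingMap, aeval_X, aeval_X]
      rcases i with i | k
      · fin_cases i <;> simp
      · simp
    rw [map_mul (rulingFamilyMap κ), map_mul (map (Polynomial.evalRingHom t)),
      map_mul (rulingMap κ t), hp, hi]

theorem rulingMap_surjective (t : ℂ) : Function.Surjective (rulingMap κ t) := by
  intro b
  refine ⟨rename (Sum.map ![0, 2] id) b, ?_⟩
  have : (rulingMap κ t).comp (rename (Sum.map ![0, 2] id)) = AlgHom.id ℂ _ := by
    ext1 i
    rcases i with i | k
    · fin_cases i <;> simp [rulingMap]
    · simp [rulingMap]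
  exact AlgHom.congr_fun this b

theorem eval_rulingMap {t : ℂ} {u : Fin 4 ⊕ κ → ℂ} (h1 : u (Sum.inl 1) = t * u (Sum.inl 2))
    (h3 : u (Sum.inl 3) = t * u (Sum.inl 0)) (f : MvPolynomial (Fin 4 ⊕ κ) ℂ) :
    eval (u ∘ Sum.map ![0, 2] id) (rulingMap κ t f) = eval u f := by
  rw [← aeval_eq_eval, ← aeval_eq_eval, ← AlgHom.comp_apply]
  congr 1
  ext1 i
  rcases i with i | k
  · fin_cases i <;> simp [rulingMap, h1, h3]
  · simp [rulingMap]

theorem isHomogeneous_rulingMap (t : ℂ) (n : ℕ) (f : MvPolynomial (Fin 4 ⊕ κ) ℂ) :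
    homogeneousComponent n (rulingMap κ t f) = rulingMap κ t (homogeneousComponent n f) := by
  refine homogeneousComponent_aeval (fun i => ?_) n f
  have hC : ∀ i : Fin 2 ⊕ κ, (C t * X i : MvPolynomial (Fin 2 ⊕ κ) ℂ).IsHomogeneous 1 := fun i => by
    simpa using (isHomogeneous_C _ t).mul (isHomogeneous_X ℂ i)
  rcases i with i | k
  · fin_cases i
    · exact isHomogeneous_X ℂ _
    · exact hC _
    · exact isHomogeneous_X ℂ _
    · exact hC _
  · exact isHomogeneous_X ℂ _

/-- The equations `y - tz` and `w - tx`. -/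
def rulingEquations (κ : Type*) (t : ℂ) : Finset (MvPolynomial (Fin 4 ⊕ κ) ℂ) :=
  open Classical in {X (Sum.inl 1) - C t * X (Sum.inl 2), X (Sum.inl 3) - C t * X (Sum.inl 0)}

theorem forall_mem_rulingEquations {t : ℂ} {p : MvPolynomial (Fin 4 ⊕ κ) ℂ → Prop} :
    (∀ h ∈ rulingEquations κ t, p h) ↔
      p (X (Sum.inl 1) - C t * X (Sum.inl 2)) ∧ p (X (Sum.inl 3) - C t * X (Sum.inl 0)) := by
  classical
  simp [rulingEquations]

theorem forall_eval_rulingEquations {t : ℂ} {u : Fin 4 ⊕ κ → ℂ} :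
    (∀ h ∈ rulingEquations κ t, eval u h = 0) ↔
      u (Sum.inl 1) = t * u (Sum.inl 2) ∧ u (Sum.inl 3) = t * u (Sum.inl 0) := by
  rw [forall_mem_rulingEquations]
  simp [sub_eq_zero]

theorem card_rulingEquations_le (t : ℂ) : (rulingEquations κ t).card ≤ 2 := by
  classical
  exact Finset.card_le_two

theorem rulingMap_ne_zero {M : ℕ} (hM : 10 ≤ M) {F : MvPolynomial (Fin 4 ⊕ κ) ℂ}
    (hF0 : eval 0 F = 0) (hline : HasNoCone M F) (t : ℂ) : rulingMap κ t F ≠ 0 := by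
  intro h0
  obtain ⟨z, hz, c, hc⟩ := hline 0 hF0 (rulingEquations κ t)
    (forall_eval_rulingEquations.mpr (by simp)) (by have := card_rulingEquations_le (κ := κ) t; omega)
  obtain ⟨h1, h3⟩ := forall_eval_rulingEquations.mp hz
  refine hc ?_
  rw [← eval_rulingMap (t := t) (by simp [h1]; ring) (by simp [h3]; ring), h0, map_zero]

theorem isUnit_or_isUnit_of_mul_eq_rulingMap [Fintype κ] {M : ℕ} (hM : 10 ≤ M)
    {F : MvPolynomial (Fin 4 ⊕ κ) ℂ} (hd : F.totalDegree ≤ M)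
    (hlow : ∀ k < 3, homogeneousComponent k F ∈ Ideal.span {quadric (0 : κ → ℂ)})
    (hline : HasNoCone M F) (t : ℂ) (a b : MvPolynomial (Fin 2 ⊕ κ) ℂ)
    (hab : a * b = rulingMap κ t F) : IsUnit a ∨ IsUnit b := by
  obtain ⟨a, rfl⟩ := rulingMap_surjective t a
  obtain ⟨b, rfl⟩ := rulingMap_surjective t b
  let I := RingHom.ker (rulingMap κ t)
  have hI : I.IsPrime := RingHom.ker_isPrime _
  have hq : quadric (0 : κ → ℂ) ∈ I := by
    rw [RingHom.mem_ker, quadric_zero]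
    simp [rulingMap]
    ring
  have hmem : ∀ u : Fin 4 ⊕ κ → ℂ, (∀ f ∈ I, eval u f = 0) ↔
      u (Sum.inl 1) = t * u (Sum.inl 2) ∧ u (Sum.inl 3) = t * u (Sum.inl 0) := by
    intro u
    refine ⟨fun h => forall_eval_rulingEquations.mp ?_, fun h f hf => ?_⟩
    · refine forall_mem_rulingEquations.mpr ⟨h _ ?_, h _ ?_⟩ <;>
      · rw [RingHom.mem_ker]
        simp [rulingMap]
    · rw [← eval_rulingMap h.1 h.2, RingHom.mem_ker.mp hf, map_zero]
  have hun : ∀ a, IsUnit (Ideal.Quotient.mk I a) → IsUnit (rulingMap κ t a) := by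
    intro a ha
    obtain ⟨r, hr⟩ := ha.exists_right_inv
    obtain ⟨r, rfl⟩ := Ideal.Quotient.mk_surjective r
    rw [← map_mul, ← map_one (Ideal.Quotient.mk _), Ideal.Quotient.eq, RingHom.mem_ker, map_sub,
      map_one, map_mul, sub_eq_zero] at hr
    exact IsUnit.of_mul_eq_one _ hr
  refine (isUnit_mk_or_isUnit_mk (I := I) hM (fun f hf k => ?_) ((hmem 0).mpr (by simp))
    (fun p hp => ?_) hd (fun k hk => ?_) hline ?_).imp (hun a) (hun b)
  · rw [RingHom.mem_ker, ← isHomogeneous_rulingMap, RingHom.mem_ker.mp hf, map_zero]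
  · refine ⟨rulingEquations κ t, card_rulingEquations_le t,
      forall_eval_rulingEquations.mpr (by simp), fun z hz c => (hmem _).mpr ?_⟩
    obtain ⟨hp1, hp3⟩ := (hmem p).mp hp
    obtain ⟨hz1, hz3⟩ := forall_eval_rulingEquations.mp hz
    simp only [Pi.add_apply, Pi.smul_apply, smul_eq_mul, hp1, hp3, hz1, hz3]
    constructor <;> ring
  · exact (Ideal.span_singleton_le_iff_mem _).mpr hq (hlow k hk)
  · rw [RingHom.mem_ker, map_sub, map_mul, hab, sub_self]

theorem rulingFamilyMap_quadric [Fintype κ] : rulingFamilyMap κ (quadric (0 : κ → ℂ)) = 0 := by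
  rw [quadric_zero]
  simp [rulingFamilyMap]
  ring

theorem ker_rulingFamilyMap_le [Fintype κ] {s : MvPolynomial (Fin 4 ⊕ κ) ℂ} (hs : rulingFamilyMap κ s = 0) :
    s ∈ Ideal.span {quadric (0 : κ → ℂ)} := by
  let A := MvPolynomial (Fin 4 ⊕ κ) ℂ ⧸ Ideal.span {quadric (0 : κ → ℂ)}
  let L := FractionRing A
  let π : MvPolynomial (Fin 4 ⊕ κ) ℂ →+* L := (algebraMap A L).comp (Ideal.Quotient.mk _)
  have hπ : ∀ f, π f = 0 → f ∈ Ideal.span {quadric (0 : κ → ℂ)} := fun f hf => by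
    exact Ideal.Quotient.eq_zero_iff_mem.mp ((FaithfulSMul.algebraMap_eq_zero_iff A L).mp hf)
  have hπq : π (X (Sum.inl 0)) * π (X (Sum.inl 1)) = π (X (Sum.inl 2)) * π (X (Sum.inl 3)) := by
    rw [← map_mul, ← map_mul, ← sub_eq_zero, ← map_sub, ← quadric_zero]
    rw [RingHom.comp_apply, Ideal.Quotient.mk_singleton_self, map_zero]
  have hx : π (X (Sum.inl 0)) ≠ 0 := by
    intro h0
    obtain ⟨r, hr⟩ := Ideal.mem_span_singleton'.mp (hπ _ h0)
    have := congrArg (eval (Sum.elim ![1, 1, 1, 1] 0)) hr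
    simp [quadric, quadricTail] at this
  let φ : MvPolynomial (Fin 2 ⊕ κ) (Polynomial ℂ) →+* L :=
    eval₂Hom (Polynomial.eval₂RingHom (π.comp C) (π (X (Sum.inl 3)) / π (X (Sum.inl 0))))
      fun i => π (X (Sum.map ![0, 2] id i))
  have hφ : φ.comp (rulingFamilyMap κ : MvPolynomial (Fin 4 ⊕ κ) ℂ →+* _) = π := by
    refine MvPolynomial.ringHom_ext (fun a => ?_) (fun i => ?_)
    · have h1 : rulingFamilyMap κ (C a) = C (Polynomial.C a) := by
        rw [rulingFamilyMap, aeval_C]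
        rfl
      rw [RingHom.comp_apply, RingHom.coe_coe, h1]
      simp [φ]
    · rcases i with i | k
      · fin_cases i
        · simp [φ, rulingFamilyMap]
        · simp [φ, rulingFamilyMap]
          rw [div_mul_eq_mul_div, div_eq_iff hx]
          linear_combination -hπq
        · simp [φ, rulingFamilyMap]
        · simp [φ, rulingFamilyMap]
          rw [div_mul_cancel₀ _ hx]
      · simp [φ, rulingFamilyMap]
  refine hπ s ?_
  rw [← hφ, RingHom.comp_apply, RingHom.coe_coe, hs, map_zero]

theorem exists_X_pow_mul_eq_rulingFamilyMap (b : MvPolynomial (Fin 2 ⊕ κ) (Polynomial ℂ)) :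
    ∃ (k : ℕ) (s : MvPolynomial (Fin 4 ⊕ κ) ℂ), X (Sum.inl 0) ^ k * b = rulingFamilyMap κ s := by
  have hadd : ∀ p q : MvPolynomial (Fin 2 ⊕ κ) (Polynomial ℂ),
      (∃ (k : ℕ) (s : MvPolynomial (Fin 4 ⊕ κ) ℂ), X (Sum.inl 0) ^ k * p = rulingFamilyMap κ s) →
      (∃ (k : ℕ) (s : MvPolynomial (Fin 4 ⊕ κ) ℂ), X (Sum.inl 0) ^ k * q = rulingFamilyMap κ s) →
      ∃ (k : ℕ) (s : MvPolynomial (Fin 4 ⊕ κ) ℂ), X (Sum.inl 0) ^ k * (p + q) =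
        rulingFamilyMap κ s := by
    rintro p q ⟨k, s, hs⟩ ⟨l, r, hr⟩
    refine ⟨k + l, X (Sum.inl 0) ^ l * s + X (Sum.inl 0) ^ k * r, ?_⟩
    rw [map_add, map_mul, map_mul, ← hs, ← hr]
    simp [rulingFamilyMap]
    ring
  induction b using MvPolynomial.induction_on with
  | C p =>
    induction p using Polynomial.induction_on' with
    | add p q hp hq =>
      rw [C_add]
      exact hadd _ _ hp hq
    | monomial n a =>
      refine ⟨n, C a * X (Sum.inl 3) ^ n, ?_⟩
      rw [map_mul, map_pow]
      have h1 : rulingFamilyMap κ (C a) = C (Polynomial.C a) := by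
        rw [rulingFamilyMap, aeval_C]
        rfl
      rw [h1, ← Polynomial.C_mul_X_pow_eq_monomial]
      simp [rulingFamilyMap]
      ring
  | add p q hp hq => exact hadd p q hp hq
  | mul_X p i hp =>
    obtain ⟨k, s, hs⟩ := hp
    refine ⟨k, s * X (Sum.map ![0, 2] id i), ?_⟩
    rw [map_mul, ← hs, mul_assoc]
    congr 2
    rcases i with i | k
    · fin_cases i <;> simp [rulingFamilyMap]
    · simp [rulingFamilyMap]

/-- The substitution `x = 0`. -/
def sectionMap (κ : Type*) : MvPolynomial (Fin 4 ⊕ κ) ℂ →ₐ[ℂ] MvPolynomial (Fin 4 ⊕ κ) ℂ :=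
  open Classical in aeval fun i => if i = Sum.inl 0 then 0 else X i

theorem X_dvd_sub_sectionMap (f : MvPolynomial (Fin 4 ⊕ κ) ℂ) :
    X (Sum.inl 0) ∣ f - sectionMap κ f := by
  rw [← Ideal.mem_span_singleton]
  refine sub_aeval_mem _ (fun i => ?_) f
  split_ifs with hi
  · rw [hi, sub_zero]
    exact Ideal.mem_span_singleton_self _
  · simp

theorem not_X_dvd_sectionMap {M : ℕ} (hM : 10 ≤ M) {F : MvPolynomial (Fin 4 ⊕ κ) ℂ}
    (hF0 : eval 0 F = 0) (hline : HasNoCone M F) (i : Fin 4 ⊕ κ) :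
    ¬ X i ∣ sectionMap κ F := by
  classical
  rintro ⟨r, hr⟩
  obtain ⟨z, hz, c, hc⟩ := hline 0 hF0 {X (Sum.inl 0), X i} (by simp)
    (by have := Finset.card_le_two (a := (X (Sum.inl 0) : MvPolynomial (Fin 4 ⊕ κ) ℂ)) (b := X i)
        omega)
  obtain ⟨s, hs⟩ := X_dvd_sub_sectionMap F
  simp only [Finset.mem_insert, Finset.mem_singleton, forall_eq_or_imp, forall_eq, eval_X] at hz
  refine hc ?_
  rw [sub_eq_iff_eq_add.mp hs, hr]
  simp [hz.1, hz.2]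

theorem mem_span_pair_of_X_mul_mem [Fintype κ] {M : ℕ} (hM : 10 ≤ M)
    {F : MvPolynomial (Fin 4 ⊕ κ) ℂ} (hF0 : eval 0 F = 0) (hline : HasNoCone M F)
    {a : MvPolynomial (Fin 4 ⊕ κ) ℂ}
    (ha : X (Sum.inl 0) * a ∈ Ideal.span {quadric (0 : κ → ℂ), F}) :
    a ∈ Ideal.span {quadric (0 : κ → ℂ), F} := by
  classical
  obtain ⟨α, β, h⟩ := Ideal.mem_span_pair.mp ha
  have hθ : X (Sum.inl 2) * (X (Sum.inl 3) * sectionMap κ α) = sectionMap κ F * sectionMap κ β := by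
    have h' := congrArg (sectionMap κ) h
    have h0 : sectionMap κ (X (Sum.inl 0)) = 0 := by simp [sectionMap]
    have h2 : sectionMap κ (X (Sum.inl 2)) = X (Sum.inl 2) := by simp [sectionMap]
    have h3 : sectionMap κ (X (Sum.inl 3)) = X (Sum.inl 3) := by simp [sectionMap]
    rw [quadric_zero, map_add, map_mul, map_mul, map_mul, map_sub, map_mul, map_mul, h0, h2, h3] at h'
    linear_combination -h'
  obtain ⟨γ, hγ⟩ := ((X_prime (i := Sum.inl 2)).dvd_or_dvd ⟨_, hθ.symm⟩).resolve_left
    (not_X_dvd_sectionMap hM hF0 hline _)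
  have hθ2 : X (Sum.inl 3) * sectionMap κ α = sectionMap κ F * γ := by
    refine mul_left_cancel₀ (X_ne_zero (Sum.inl 2)) ?_
    rw [hθ, hγ]
    ring
  obtain ⟨γ, rfl⟩ := ((X_prime (i := Sum.inl 3)).dvd_or_dvd ⟨_, hθ2.symm⟩).resolve_left
    (not_X_dvd_sectionMap hM hF0 hline _)
  obtain ⟨δ, hδ⟩ := X_dvd_sub_sectionMap β
  rw [hγ] at hδ
  have hx : X (Sum.inl 0) * (a - F * (X (Sum.inl 1) * γ + δ)) =
      quadric (0 : κ → ℂ) * (α - F * γ) := by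
    rw [quadric_zero] at h ⊢
    linear_combination -h + F * hδ
  obtain ⟨ε, hε⟩ := ((X_prime (i := Sum.inl 0)).dvd_or_dvd ⟨_, hx.symm⟩).resolve_left
    (not_X_dvd_of_eval_ne_zero (Sum.elim ![0, 0, 1, 1] 0) (by simp) (by simp [quadric_zero]))
  refine Ideal.mem_span_pair.mpr ⟨ε, X (Sum.inl 1) * γ + δ, mul_left_cancel₀ (X_ne_zero (Sum.inl 0)) ?_⟩
  rw [hε] at hx
  linear_combination -hx

theorem isPrime_span_quadric_pair_zero [Fintype κ] {M : ℕ} (hM : 10 ≤ M)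
    {F : MvPolynomial (Fin 4 ⊕ κ) ℂ} (hd : F.totalDegree ≤ M)
    (hlow : ∀ k < 3, homogeneousComponent k F ∈ Ideal.span {quadric (0 : κ → ℂ)})
    (hline : HasNoCone M F) : (Ideal.span {quadric (0 : κ → ℂ), F}).IsPrime := by
  have hF0 := eval_zero_eq_zero_of_low hlow
  have hirr : Irreducible (rulingFamilyMap κ F) := by
    refine irreducible_of_forall_specialization (fun hu => ?_) (fun t => ?_) (fun t a b hab => ?_)
    · have h1 := hu.map (map (Polynomial.evalRingHom (0 : ℂ)))
      rw [map_rulingFamilyMap] at h1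
      have h2 := h1.map (eval ((0 : Fin 4 ⊕ κ → ℂ) ∘ Sum.map ![0, 2] id))
      rw [eval_rulingMap (by simp) (by simp), hF0] at h2
      exact not_isUnit_zero h2
    · rw [map_rulingFamilyMap]
      exact rulingMap_ne_zero hM hF0 hline t
    · rw [map_rulingFamilyMap] at hab
      exact isUnit_or_isUnit_of_mul_eq_rulingMap hM hd hlow hline t a b hab
  have hprime := (Ideal.span_singleton_prime hirr.ne_zero).mpr hirr.prime
  have heq : Ideal.span {quadric (0 : κ → ℂ), F} =
      (Ideal.span {rulingFamilyMap κ F}).comap (rulingFamilyMap κ) := by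
    apply le_antisymm
    · rw [Ideal.span_le]
      rintro _ (rfl | rfl)
      · simp [rulingFamilyMap_quadric]
      · simp
    · intro a ha
      obtain ⟨b, hb⟩ := Ideal.mem_span_singleton'.mp (Ideal.mem_comap.mp ha)
      obtain ⟨k, s, hs⟩ := exists_X_pow_mul_eq_rulingFamilyMap b
      have hX : rulingFamilyMap κ (X (Sum.inl 0)) = X (Sum.inl 0) := by simp [rulingFamilyMap]
      have h1 : X (Sum.inl 0) ^ k * a - s * F ∈ Ideal.span {quadric (0 : κ → ℂ)} := by
        refine ker_rulingFamilyMap_le ?_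
        rw [map_sub, map_mul, map_mul, map_pow, hX, ← hs, ← hb]
        ring
      have h2 : X (Sum.inl 0) ^ k * a ∈ Ideal.span {quadric (0 : κ → ℂ), F} := by
        have h3 := Ideal.add_mem _ (Ideal.span_mono (by simp) h1 :
          _ ∈ Ideal.span {quadric (0 : κ → ℂ), F})
          (Ideal.mul_mem_left _ s (Ideal.subset_span (by simp) : F ∈ _))
        rwa [sub_add_cancel] at h3
      clear hs h1
      induction k with
      | zero => simpa using h2
      | succ k ih =>
        refine ih (mem_span_pair_of_X_mul_mem hM hF0 hline ?_)
        rwa [pow_succ', mul_assoc] at h2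
  rw [heq]
  exact Ideal.IsPrime.comap _

theorem isPrime_span_quadric_pair [Fintype κ] {M : ℕ} (hM : 10 ≤ M) (c : κ → ℂ)
    {F : MvPolynomial (Fin 4 ⊕ κ) ℂ} (hd : F.totalDegree ≤ M)
    (hlow : ∀ k < 3, homogeneousComponent k F ∈ Ideal.span {quadric c})
    (hline : HasNoCone M F) : (Ideal.span {quadric c, F}).IsPrime := by
  rcases eq_or_ne c 0 with rfl | hc
  · exact isPrime_span_quadric_pair_zero hM hd hlow hline
  · exact isPrime_span_quadric_pair_of_ne_zero hM hc hd hlow hline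

end SplitQuadric

section LinearForms

variable {σ τ : Type*} [Fintype σ]

/-- The homogeneous polynomial of degree one defining a linear functional. -/
def linForm (σ : Type*) [Fintype σ] : Module.Dual ℂ (σ → ℂ) →ₗ[ℂ] MvPolynomial σ ℂ where
  toFun φ := ∑ i, C (φ (Pi.basisFun ℂ σ i)) * X i
  map_add' φ ψ := by
    rw [← Finset.sum_add_distrib]
    exact Finset.sum_congr rfl fun i _ => by rw [LinearMap.add_apply, C_add, add_mul]
  map_smul' a φ := by
    rw [Finset.smul_sum]
    exact Finset.sum_congr rfl fun i _ => by
      rw [LinearMap.smul_apply, smul_eq_mul, C_mul, smul_eq_C_mul, RingHom.id_apply, mul_assoc]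

theorem eval_linForm (φ : Module.Dual ℂ (σ → ℂ)) (z : σ → ℂ) : eval z (linForm σ φ) = φ z := by
  conv_rhs => rw [← (Pi.basisFun ℂ σ).sum_repr z, map_sum]
  simp [linForm, mul_comm]

theorem isHomogeneous_linForm (φ : Module.Dual ℂ (σ → ℂ)) : (linForm σ φ).IsHomogeneous 1 :=
  IsHomogeneous.sum _ _ _ fun i _ => by simpa using (isHomogeneous_C _ _).mul (isHomogeneous_X ℂ i)

theorem linForm_proj (i : σ) : linForm σ (LinearMap.proj i) = X i :=
  MvPolynomial.funext fun z => by rw [eval_linForm, eval_X, LinearMap.proj_apply]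

theorem exists_linForm_eq {l : MvPolynomial σ ℂ} (hl : l.IsHomogeneous 1) :
    ∃ φ, linForm σ φ = l := by
  have h : l ∈ homogeneousSubmodule σ ℂ 1 := hl
  rw [homogeneousSubmodule_one_eq_span_X] at h
  have h2 : Submodule.span ℂ (Set.range X) ≤ LinearMap.range (linForm σ) := by
    rw [Submodule.span_le]
    rintro _ ⟨i, rfl⟩
    exact ⟨_, linForm_proj i⟩
  exact h2 h

theorem exists_quadraticForm_eq {q : MvPolynomial σ ℂ} (hq : q.IsHomogeneous 2) :
    ∃ Q : QuadraticForm ℂ (σ → ℂ), ∀ z, Q z = eval z q := by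
  have h : q ∈ homogeneousSubmodule σ ℂ 2 := hq
  rw [← homogeneousSubmodule_one_pow, pow_two] at h
  refine Submodule.mul_induction_on h (fun m hm n hn => ?_) ?_
  · obtain ⟨φ, rfl⟩ := exists_linForm_eq hm
    obtain ⟨ψ, rfl⟩ := exists_linForm_eq hn
    exact ⟨QuadraticMap.linMulLin φ ψ, fun z => by simp [eval_linForm]⟩
  · rintro x y ⟨Q, hQ⟩ ⟨R, hR⟩
    exact ⟨Q + R, fun z => by simp [hQ, hR]⟩

/-- Pullback of polynomials along a linear map. -/
def linPullback (T : (σ → ℂ) →ₗ[ℂ] (τ → ℂ)) : MvPolynomial τ ℂ →ₐ[ℂ] MvPolynomial σ ℂ :=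
  aeval fun i => linForm σ (LinearMap.proj i ∘ₗ T)

theorem eval_linPullback (T : (σ → ℂ) →ₗ[ℂ] (τ → ℂ)) (u : σ → ℂ) (f : MvPolynomial τ ℂ) :
    eval u (linPullback T f) = eval (T u) f := by
  rw [← aeval_eq_eval, ← aeval_eq_eval, ← AlgHom.comp_apply]
  congr 1
  ext1 i
  simp [linPullback, aeval_eq_eval, eval_linForm]

theorem homogeneousComponent_linPullback (T : (σ → ℂ) →ₗ[ℂ] (τ → ℂ)) (n : ℕ)
    (f : MvPolynomial τ ℂ) :
    homogeneousComponent n (linPullback T f) = linPullback T (homogeneousComponent n f) :=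
  homogeneousComponent_aeval (fun _ => isHomogeneous_linForm _) n f

theorem totalDegree_linPullback_le (T : (σ → ℂ) →ₗ[ℂ] (τ → ℂ)) (f : MvPolynomial τ ℂ) :
    (linPullback T f).totalDegree ≤ f.totalDegree :=
  totalDegree_aeval_le _ (fun _ => (isHomogeneous_linForm _).totalDegree_le) f

/-- A polynomial differs from its pullback under an endomorphism `T` by an element of the ideal of
a linear space on which `T` is the identity. -/
theorem sub_linPullback_mem {ι : Type*} [Finite ι] (φ : ι → Module.Dual ℂ (σ → ℂ))
    (T : (σ → ℂ) →ₗ[ℂ] (σ → ℂ)) (hT : ∀ z, (∀ i, φ i z = 0) → T z = z) (f : MvPolynomial σ ℂ) :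
    f - linPullback T f ∈ Ideal.span (Set.range fun i => linForm σ (φ i)) := by
  refine sub_aeval_mem _ (fun i => ?_) f
  rw [← linForm_proj, ← map_sub]
  have h : LinearMap.proj i - LinearMap.proj i ∘ₗ T ∈ Submodule.span ℂ (Set.range φ) := by
    refine mem_span_of_iInf_ker_le_ker fun z hz => ?_
    have hz' : ∀ i, φ i z = 0 := by simpa using hz
    simp [hT z hz']
  have h2 : Submodule.span ℂ (Set.range φ) ≤
      ((Ideal.span (Set.range fun i => linForm σ (φ i))).restrictScalars ℂ).comap (linForm σ) := by
    rw [Submodule.span_le]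
    rintro _ ⟨i, rfl⟩
    exact Ideal.subset_span ⟨i, rfl⟩
  exact h2 h

/-- Primality of the ideal generated by linear forms and two further polynomials can be tested on
the linear space cut out by the linear forms. -/
theorem isPrime_sup_span_pair [Fintype τ] {ι : Type*} [Finite ι] (φ : ι → Module.Dual ℂ (τ → ℂ))
    (B : (σ → ℂ) →ₗ[ℂ] (τ → ℂ)) (A : (τ → ℂ) →ₗ[ℂ] (σ → ℂ)) (hB : ∀ i u, φ i (B u) = 0)
    (hBA : ∀ z, (∀ i, φ i z = 0) → B (A z) = z) (q f : MvPolynomial τ ℂ)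
    (h : (Ideal.span {linPullback B q, linPullback B f}).IsPrime) :
    (Ideal.span (Set.range fun i => linForm τ (φ i)) ⊔ Ideal.span {q, f}).IsPrime := by
  set K := Ideal.span (Set.range fun i => linForm τ (φ i))
  have hK : ∀ f, f - linPullback A (linPullback B f) ∈ K := fun f => by
    convert sub_linPullback_mem φ (B ∘ₗ A) hBA f using 2
    exact MvPolynomial.funext fun z => by simp [eval_linPullback]
  have heq : K ⊔ Ideal.span {q, f} =
      (Ideal.span {linPullback B q, linPullback B f}).comap (linPullback B) := by
    apply le_antisymm
    · rw [sup_le_iff, Ideal.span_le, Ideal.span_le]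
      constructor
      · rintro _ ⟨i, rfl⟩
        have : linPullback B (linForm τ (φ i)) = 0 :=
          MvPolynomial.funext fun z => by simp [eval_linPullback, eval_linForm, hB]
        simp [this]
      · rintro _ (rfl | rfl)
        · exact Ideal.subset_span (by simp)
        · exact Ideal.subset_span (by simp)
    · intro a ha
      obtain ⟨α, β, hab⟩ := Ideal.mem_span_pair.mp (Ideal.mem_comap.mp ha)
      have hmem : ∀ p ∈ Ideal.span {q, f}, linPullback A (linPullback B p) ∈
          K ⊔ Ideal.span {q, f} := fun p hp => by
        have := Ideal.sub_mem _ (Ideal.mem_sup_right hp : p ∈ K ⊔ Ideal.span {q, f})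
          (Ideal.mem_sup_left (hK p))
        rwa [sub_sub_cancel] at this
      have h1 : linPullback A (linPullback B a) ∈ K ⊔ Ideal.span {q, f} := by
        change _ = linPullback B a at hab
        rw [← hab, map_add, map_mul, map_mul]
        exact Ideal.add_mem _ (Ideal.mul_mem_left _ _ (hmem q (Ideal.subset_span (by simp))))
          (Ideal.mul_mem_left _ _ (hmem f (Ideal.subset_span (by simp))))
      have := Ideal.add_mem _ (Ideal.mem_sup_left (hK a) : _ ∈ K ⊔ Ideal.span {q, f}) h1
      rwa [sub_add_cancel] at this
  rw [heq]
  exact Ideal.IsPrime.comap _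

end LinearForms

section NormalForm

theorem eval_quadric {κ : Type*} [Fintype κ] (c : κ → ℂ) (u : Fin 4 ⊕ κ → ℂ) :
    eval u (quadric c) = u (Sum.inl 0) * u (Sum.inl 1) - u (Sum.inl 2) * u (Sum.inl 3) +
      ∑ k, c k * u (Sum.inr k) ^ 2 := by
  simp [quadric, quadricTail]
  ring

/-- The change of coordinates taking a diagonal form to one whose leading part is `xy - zw`. -/
theorem exists_linearEquiv_quadric {κ : Type*} [Fintype κ] (w : Fin 4 ⊕ κ → ℂ)
    (hw : ∀ i, w (Sum.inl i) ≠ 0) :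
    ∃ e : (Fin 4 ⊕ κ → ℂ) ≃ₗ[ℂ] (Fin 4 ⊕ κ → ℂ), ∀ y,
      eval (e y) (quadric (w ∘ Sum.inr)) = ∑ i, w i * y i ^ 2 := by
  choose s hs using fun i : Fin 4 => IsAlgClosed.exists_pow_nat_eq (w (Sum.inl i)) two_pos
  have hs0 : ∀ i, s i ≠ 0 := fun i h => hw i (by rw [← hs, h]; norm_num)
  let p (i : Fin 4 ⊕ κ) : (Fin 4 ⊕ κ → ℂ) →ₗ[ℂ] ℂ := LinearMap.proj i
  let L : (Fin 4 ⊕ κ → ℂ) →ₗ[ℂ] (Fin 4 ⊕ κ → ℂ) := LinearMap.pi (Sum.elim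
    ![s 0 • p (Sum.inl 0) + (Complex.I * s 1) • p (Sum.inl 1),
      s 0 • p (Sum.inl 0) - (Complex.I * s 1) • p (Sum.inl 1),
      s 2 • p (Sum.inl 2) + (Complex.I * s 3) • p (Sum.inl 3),
      (Complex.I * s 3) • p (Sum.inl 3) - s 2 • p (Sum.inl 2)] fun k => p (Sum.inr k))
  have hL0 : ∀ y, L y (Sum.inl 0) = s 0 * y (Sum.inl 0) + Complex.I * s 1 * y (Sum.inl 1) :=
    fun y => by simp [L, p]
  have hL1 : ∀ y, L y (Sum.inl 1) = s 0 * y (Sum.inl 0) - Complex.I * s 1 * y (Sum.inl 1) :=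
    fun y => by simp [L, p]
  have hL2 : ∀ y, L y (Sum.inl 2) = s 2 * y (Sum.inl 2) + Complex.I * s 3 * y (Sum.inl 3) :=
    fun y => by simp [L, p]
  have hL3 : ∀ y, L y (Sum.inl 3) = Complex.I * s 3 * y (Sum.inl 3) - s 2 * y (Sum.inl 2) :=
    fun y => by simp [L, p]
  have hLr : ∀ y k, L y (Sum.inr k) = y (Sum.inr k) := fun y k => by simp [L, p]
  have hinj : Function.Injective L := by
    rw [← LinearMap.ker_eq_bot, LinearMap.ker_eq_bot']
    intro y hy
    have h0 := hL0 y
    have h1 := hL1 y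
    have h2 := hL2 y
    have h3 := hL3 y
    simp only [hy, Pi.zero_apply] at h0 h1 h2 h3
    have e0 : s 0 * y (Sum.inl 0) = 0 := by linear_combination (-h0 - h1) / 2
    have e1 : Complex.I * s 1 * y (Sum.inl 1) = 0 := by linear_combination (-h0 + h1) / 2
    have e2 : s 2 * y (Sum.inl 2) = 0 := by linear_combination (-h2 + h3) / 2
    have e3 : Complex.I * s 3 * y (Sum.inl 3) = 0 := by linear_combination (-h2 - h3) / 2
    simp only [mul_eq_zero, Complex.I_ne_zero, hs0, false_or] at e0 e1 e2 e3
    ext i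
    rcases i with i | k
    · fin_cases i
      exacts [e0, e1, e2, e3]
    · rw [← hLr y k, hy]
  refine ⟨LinearEquiv.ofInjectiveEndo L hinj, fun y => ?_⟩
  rw [LinearEquiv.coe_ofInjectiveEndo, eval_quadric, hL0, hL1, hL2, hL3, Fintype.sum_sum_type,
    Fin.sum_univ_four, ← hs, ← hs, ← hs, ← hs]
  simp only [hLr, Function.comp_apply]
  linear_combination (-(s 1 * y (Sum.inl 1)) ^ 2 - (s 3 * y (Sum.inl 3)) ^ 2) * Complex.I_sq

/-- A complex quadratic form is either a sum of at most three squares, or equivalent to a form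
`xy - zw + ∑ cₖ uₖ²`. -/
theorem exists_sum_sq_or_exists_quadric {E : Type*} [AddCommGroup E] [Module ℂ E]
    [FiniteDimensional ℂ E] (Q : QuadraticForm ℂ E) :
    (∃ m : Fin 3 → Module.Dual ℂ E, ∀ x, Q x = ∑ i, m i x ^ 2) ∨
    ∃ (κ : Type) (_ : Fintype κ) (c : κ → ℂ) (e : E ≃ₗ[ℂ] (Fin 4 ⊕ κ → ℂ)), ∀ x,
      Q x = eval (e x) (quadric c) := by
  classical
  obtain ⟨w, ⟨e⟩⟩ := QuadraticForm.equivalent_weightedSumSquares Q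
  have he : ∀ x, Q x = ∑ i, w i * e x i ^ 2 := fun x => by
    rw [← e.map_app x, QuadraticMap.weightedSumSquares_apply]
    simp [pow_two]
  by_cases hcard : Fintype.card {i // w i ≠ 0} ≤ 3
  · left
    obtain ⟨g⟩ : Nonempty ({i // w i ≠ 0} ↪ Fin 3) :=
      Function.Embedding.nonempty_of_card_le (by simpa using hcard)
    choose s hs using fun i => IsAlgClosed.exists_pow_nat_eq (w i) two_pos
    let t : Fin 3 → Module.Dual ℂ E := fun k =>
      if h : ∃ i, g i = k then s h.choose • (LinearMap.proj h.choose.1 ∘ₗ e.toLinearEquiv.toLinearMap)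
      else 0
    have ht : ∀ i, t (g i) = s i • (LinearMap.proj i.1 ∘ₗ e.toLinearEquiv.toLinearMap) := fun i => by
      have h : ∃ i', g i' = g i := ⟨i, rfl⟩
      have hi : h.choose = i := g.injective h.choose_spec
      simp only [t, dif_pos h, hi]
    refine ⟨t, fun x => ?_⟩
    have h1 : ∑ k, t k x ^ 2 = ∑ i, t (g i) x ^ 2 := by
      refine (Fintype.sum_of_injective g g.injective _ _ (fun k hk => ?_) fun _ => rfl).symm
      have h : ¬ ∃ i, g i = k := hk
      simp only [t, dif_neg h, LinearMap.zero_apply, ne_eq, OfNat.ofNat_ne_zero,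
        not_false_eq_true, zero_pow]
    rw [h1, he]
    refine (Fintype.sum_of_injective Subtype.val Subtype.val_injective _ _ (fun k hk => ?_)
      fun i => ?_).symm
    · have : w k = 0 := by simpa using hk
      simp [this]
    · rw [ht, ← hs]
      simp [mul_pow]
  · right
    obtain ⟨g⟩ : Nonempty (Fin 4 ↪ {i // w i ≠ 0}) :=
      Function.Embedding.nonempty_of_card_le (by rw [Fintype.card_fin]; omega)
    let g' : Fin 4 → Fin (Module.finrank ℂ E) := fun i => (g i).1
    have hg' : Function.Injective g' := Subtype.val_injective.comp g.injective
    let S := (Set.range g')ᶜ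
    let ε : Fin 4 ⊕ S ≃ Fin (Module.finrank ℂ E) :=
      (Equiv.sumCongr (Equiv.ofInjective g' hg') (Equiv.refl _)).trans (Equiv.Set.sumCompl _)
    obtain ⟨L, hL⟩ := exists_linearEquiv_quadric (w ∘ ε) fun i => by
      have : ε (Sum.inl i) = g' i := Equiv.Set.sumCompl_apply_inl _ _
      rw [Function.comp_apply, this]
      exact (g i).2
    refine ⟨S, inferInstance, (w ∘ ε) ∘ Sum.inr,
      e.toLinearEquiv.trans ((LinearEquiv.funCongrLeft ℂ ℂ ε).trans L), fun x => ?_⟩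
    rw [LinearEquiv.trans_apply, LinearEquiv.trans_apply, hL, he, ← ε.sum_comp]
    rfl

end NormalForm

section Chart

theorem zdim_mono {E : Type*} [AddCommGroup E] [Module ℂ E] {A B : Set E} (h : A ⊆ B) :
    zdim A ≤ zdim B := by
  let _ := zariskiTopology E
  exact (Topology.IsInducing.subtypeVal.codRestrict (s := B) fun x : A =>
    h x.2).topologicalKrullDim_le

variable {M : ℕ} {G : MvPolynomial (Fin (M + 1)) ℂ} {v : Fin (M + 1) → ℂ} {j : Fin (M + 1)}

theorem eval_chartShift {y : Fin (M + 1) → ℂ} (hy : y j = 0) :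
    eval y (chartShift G v j) = eval (v + y) G := by
  rw [← aeval_eq_eval, ← aeval_eq_eval, chartShift, aeval_bind₁]
  congr 2
  ext i
  split_ifs with hi
  · simp [hi, hy]
  · simp

theorem totalDegree_chartShift_le (G : MvPolynomial (Fin (M + 1)) ℂ) (v : Fin (M + 1) → ℂ)
    (j : Fin (M + 1)) : (chartShift G v j).totalDegree ≤ G.totalDegree := by
  refine totalDegree_aeval_le _ (fun i => ?_) G
  split_ifs
  · simp
  · exact (totalDegree_add _ _).trans (by simp)

theorem eval_chartComp_eq_zero_of_forall {z : Fin (M + 1) → ℂ} (hz : z j = 0)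
    (h : ∀ c : ℂ, eval (v + c • z) G = 0) (k : ℕ) : eval z (chartComp k G v j) = 0 := by
  set f := chartShift G v j
  have h1 : ∑ k ∈ Finset.range (f.totalDegree + k + 1),
      Polynomial.monomial k (eval z (homogeneousComponent k f)) = 0 := by
    refine Polynomial.funext fun c => ?_
    have h2 := eval_smul_eq_sum (f := f) (d := f.totalDegree + k) (by omega) c z
    rw [eval_chartShift (by simp [hz]), h c] at h2
    rw [Polynomial.eval_finsetSum, Polynomial.eval_zero, h2]
    exact Finset.sum_congr rfl fun i _ => by rw [Polynomial.eval_monomial, mul_comm]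
  have h3 := congrArg (fun p => Polynomial.coeff p k) h1
  simpa [chartComp, f, Polynomial.finsetSum_coeff, Polynomial.coeff_monomial] using h3

/-- On a regular hypersurface, the cone of lines through a point meeting a linear section of the
chart is too small to contain the zero set of few equations. -/
theorem exists_eval_add_smul_ne_zero (hreg : FRegular G) (hv : v j = 1) (hvG : eval v G = 0)
    (H : Finset (MvPolynomial (Fin (M + 1)) ℂ)) (hX : X j ∈ H) (hH : ∀ h ∈ H, eval 0 h = 0)
    (hcard : H.card + 2 ≤ M + 1) :
    ∃ z, (∀ h ∈ H, eval z h = 0) ∧ ∃ c : ℂ, eval (v + c • z) G ≠ 0 := by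
  by_contra! hcon
  have h2 := two_le_zdim H hH hcard
  have hj : ∀ z, (∀ h ∈ H, eval z h = 0) → z j = 0 := fun z hz => by simpa using hz _ hX
  have hle : zdim {z : Fin (M + 1) → ℂ | ∀ h ∈ H, eval z h = 0} ≤ 1 := by
    by_cases hs : chartComp 1 G v j = 0
    · have h21 := ((hreg v j hv hvG).2 hs).1
      refine (zdim_mono ?_).trans (h21 0 (by simp) _ le_rfl ?_)
      · intro z hz
        exact ⟨hj z hz, fun i _ => eval_chartComp_eq_zero_of_forall (hj z hz) (hcon z hz) i⟩
      · have h0 : (LinearMap.proj j : Module.Dual ℂ (Fin (M + 1) → ℂ)) ≠ 0 := fun h0 => by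
          have := LinearMap.congr_fun h0 v
          simp [hv] at this
        have := Module.Dual.finrank_ker_add_one_of_ne_zero h0
        rw [Module.finrank_fin_fun] at this
        omega
    · refine (zdim_mono ?_).trans ((hreg v j hv hvG).1 hs).1
      intro z hz
      exact ⟨hj z hz, fun i _ => eval_chartComp_eq_zero_of_forall (hj z hz) (hcon z hz) i⟩
  have h3 := h2.trans hle
  exact absurd h3 (by decide)

theorem hasNoCone_linPullback {σ : Type*} [Fintype σ] (hreg : FRegular G) (hv : v j = 1)
    (φ : Fin 3 → Module.Dual ℂ (Fin (M + 1) → ℂ)) (hφ : φ 0 = LinearMap.proj j)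
    (B : (σ → ℂ) →ₗ[ℂ] (Fin (M + 1) → ℂ)) (A : (Fin (M + 1) → ℂ) →ₗ[ℂ] (σ → ℂ))
    (hB : ∀ i u, φ i (B u) = 0) (hBA : ∀ z, (∀ i, φ i z = 0) → B (A z) = z) :
    HasNoCone M (linPullback B (chartShift G v j)) := by
  classical
  intro p hp H hH hcard
  have hBj : ∀ u, B u j = 0 := fun u => by simpa [hφ] using hB 0 u
  rw [eval_linPullback, eval_chartShift (hBj p)] at hp
  let N : Finset (MvPolynomial (Fin (M + 1)) ℂ) :=
    (Finset.univ.image fun i => linForm _ (φ i)) ∪ H.image (linPullback A)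
  have hφN : ∀ i, linForm _ (φ i) ∈ N := fun i =>
    Finset.mem_union_left _ (Finset.mem_image.mpr ⟨i, Finset.mem_univ _, rfl⟩)
  have hN : ∀ h ∈ N, eval 0 h = 0 := by
    intro h hh
    rcases Finset.mem_union.mp hh with hh | hh
    · obtain ⟨i, -, rfl⟩ := Finset.mem_image.mp hh
      rw [eval_linForm, map_zero]
    · obtain ⟨g, hg, rfl⟩ := Finset.mem_image.mp hh
      rw [eval_linPullback, map_zero, hH g hg]
  have hNcard : N.card + 2 ≤ M + 1 := by
    have h1 : N.card ≤ _ := Finset.card_union_le (Finset.univ.image fun i => linForm _ (φ i))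
      (H.image (linPullback A))
    have h2 := (Finset.card_image_le (s := Finset.univ) (f := fun i => linForm _ (φ i)))
    have h3 := (Finset.card_image_le (s := H) (f := linPullback A))
    rw [Finset.card_univ, Fintype.card_fin] at h2
    omega
  have hX : X j ∈ N := by
    have := hφN 0
    rwa [hφ, linForm_proj] at this
  obtain ⟨z, hz, c, hc⟩ := exists_eval_add_smul_ne_zero hreg (v := v + B p) (j := j)
    (by simp [hv, hBj]) hp N hX hN hNcard
  have hz1 : ∀ i, φ i z = 0 := fun i => by
    rw [← eval_linForm]
    exact hz _ (hφN i)
  refine ⟨A z, fun h hh => ?_, c, ?_⟩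
  · rw [← eval_linPullback]
    exact hz _ (Finset.mem_union_right _ (Finset.mem_image_of_mem _ hh))
  · rwa [eval_linPullback, eval_chartShift (hBj _), map_add, map_smul, hBA z hz1, ← add_assoc]

theorem exists_mul_eq_sq_add_sq {E : Type*} [AddCommGroup E] [Module ℂ E] (l n : Module.Dual ℂ E) :
    ∃ a b : Module.Dual ℂ E, ∀ z, l z * n z = a z ^ 2 + b z ^ 2 := by
  refine ⟨(1 / 2 : ℂ) • (l + n), (Complex.I / 2) • (l - n), fun z => ?_⟩
  simp only [LinearMap.smul_apply, LinearMap.add_apply, LinearMap.sub_apply, smul_eq_mul]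
  linear_combination -((l z - n z) / 2) ^ 2 * Complex.I_sq

theorem homogeneousComponent_two_mul {σ : Type*} (a : MvPolynomial σ ℂ) {l : MvPolynomial σ ℂ}
    (hl : l.IsHomogeneous 1) :
    homogeneousComponent 2 (a * l) = homogeneousComponent 1 a * l := by
  have h : ∀ k, homogeneousComponent k l = if k = 1 then l else 0 :=
    fun k => homogeneousComponent_of_mem hl
  rw [homogeneousComponent_mul, Finset.sum_eq_single (1, 1), h, if_pos rfl]
  · rintro ⟨i, k⟩ hik hne
    rw [Finset.HasAntidiagonal.mem_antidiagonal] at hik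
    rw [h, if_neg, mul_zero]
    rintro rfl
    exact hne (by simpa using hik)
  · simp

/-- A quadratic form which is a sum of three squares on a linear space of codimension two is a sum
of seven squares. -/
theorem rankOn_le_seven {n : ℕ} {q : MvPolynomial (Fin n) ℂ} (hq : q.IsHomogeneous 2)
    (φ : Fin 3 → Module.Dual ℂ (Fin n → ℂ)) (T : (Fin n → ℂ) →ₗ[ℂ] (Fin n → ℂ))
    (hφT : ∀ i z, φ i (T z) = 0)
    (hT : ∀ z, (∀ i, φ i z = 0) → T z = z) (m : Fin 3 → Module.Dual ℂ (Fin n → ℂ))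
    (hm : ∀ z, (∀ i, φ i z = 0) → eval z q = ∑ i, m i z ^ 2) :
    rankOn q {z | φ 0 z = 0} ≤ 7 := by
  let p := q - ∑ i, linForm _ (m i) ^ 2
  have hp : p.IsHomogeneous 2 := hq.sub (IsHomogeneous.sum _ _ _ fun i _ => by
    simpa using (isHomogeneous_linForm (m i)).pow 2)
  have hpT : linPullback T p = 0 := MvPolynomial.funext fun z => by
    simp [eval_linPullback, p, eval_linForm, hm _ fun i => hφT i z]
  have hmem := sub_linPullback_mem φ T hT p
  rw [hpT, sub_zero] at hmem
  obtain ⟨a, ha⟩ := (Submodule.mem_span_range_iff_exists_fun _).mp hmem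
  have h2 := congrArg (homogeneousComponent 2) ha
  simp only [map_sum, smul_eq_mul, homogeneousComponent_two_mul _ (isHomogeneous_linForm _)] at h2
  rw [homogeneousComponent_of_mem hp, if_pos rfl] at h2
  choose ψ hψ using fun i => exists_linForm_eq (homogeneousComponent_isHomogeneous 1 (a i))
  obtain ⟨a₁, b₁, h₁⟩ := exists_mul_eq_sq_add_sq (ψ 1) (φ 1)
  obtain ⟨a₂, b₂, h₂⟩ := exists_mul_eq_sq_add_sq (ψ 2) (φ 2)
  refine Nat.sInf_le ⟨![m 0, m 1, m 2, a₁, b₁, a₂, b₂], fun z hz => ?_⟩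
  have h3 := congrArg (eval z) h2
  have hz0 : φ 0 z = 0 := hz
  simp only [p, ← hψ, Fin.sum_univ_three, eval_add, eval_mul, eval_sub, eval_pow, eval_linForm, hz0,
    h₁, h₂] at h3
  simp [Fin.sum_univ_succ]
  linear_combination -h3

end Chart

/-- Lemma 2.2: let `F = {G = 0} ∈ ℱ_reg` be a regular hypersurface
of degree `M ≥ 10` in `ℙ^M`, `o = v` a singular point of `F` (in the chart `z_j = 1`,
so the local equation is `q₂ + q₃ + ⋯ + q_M`), `D₂ = {q₂|_F = 0}` the first
hypertangent divisor at `o`, and `P ⊆ F` the section of `F` by an arbitrary linear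
subspace of `ℙ^M` of codimension two containing `o` (cut out in the chart by two
linear forms `l₁, l₂` independent from `X_j`). Then the restriction `D₂|_P` is an
irreducible and reduced divisor on the hypersurface `P ⊂ ℙ^{M−2}`: the ideal of its
local equations is prime. -/
theorem hypertangent_restriction_irreducible (M : ℕ) (hM : 10 ≤ M)
    (G : MvPolynomial (Fin (M + 1)) ℂ) (hG : G.IsHomogeneous M) (hG0 : G ≠ 0)
    (hreg : FRegular G)
    (v : Fin (M + 1) → ℂ) (j : Fin (M + 1)) (hv : v j = 1)
    (hvG : MvPolynomial.eval v G = 0)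
    (hsing : chartComp 1 G v j = 0)
    (l₁ l₂ : MvPolynomial (Fin (M + 1)) ℂ)
    (hl₁ : l₁.IsHomogeneous 1) (hl₂ : l₂.IsHomogeneous 1)
    (hindep : LinearIndependent ℂ ![MvPolynomial.X j, l₁, l₂]) :
    (Ideal.span ({MvPolynomial.X j, l₁, l₂, chartComp 2 G v j, chartShift G v j} :
        Set (MvPolynomial (Fin (M + 1)) ℂ))).IsPrime := by

  obtain ⟨φ₁, rfl⟩ := exists_linForm_eq hl₁
  obtain ⟨φ₂, rfl⟩ := exists_linForm_eq hl₂
  let φ : Fin 3 → Module.Dual ℂ (Fin (M + 1) → ℂ) := ![LinearMap.proj j, φ₁, φ₂]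
  let P : Submodule ℂ (Fin (M + 1) → ℂ) := ⨅ i, LinearMap.ker (φ i)
  have hP : ∀ {z}, z ∈ P ↔ ∀ i, φ i z = 0 := by simp [P]
  obtain ⟨π, hπ⟩ := LinearMap.exists_extend (LinearMap.id : P →ₗ[ℂ] P)
  have hπ' : ∀ z : P, π z = z := LinearMap.congr_fun hπ
  have hq : (chartComp 2 G v j).IsHomogeneous 2 := homogeneousComponent_isHomogeneous _ _
  obtain ⟨Q, hQ⟩ := exists_quadraticForm_eq hq
  rcases exists_sum_sq_or_exists_quadric (Q.comp P.subtype) with ⟨m, hm⟩ | ⟨κ, _, c, e, he⟩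
  · have h8 : 8 ≤ rankOn (chartComp 2 G v j) {z | φ 0 z = 0} :=
      ((hreg v j hv hvG).2 hsing).2.1
    have h7 := rankOn_le_seven hq φ (P.subtype ∘ₗ π) (fun i z => hP.mp (π z).2 i)
      (fun z hz => congrArg Subtype.val (hπ' ⟨z, hP.mpr hz⟩)) (fun i => m i ∘ₗ π) fun z hz => by
        have h1 := hm ⟨z, hP.mpr hz⟩
        simp only [LinearMap.comp_apply, hπ' ⟨z, hP.mpr hz⟩]
        rw [← h1, ← hQ]
        rfl
    omega
  let B : (Fin 4 ⊕ κ → ℂ) →ₗ[ℂ] (Fin (M + 1) → ℂ) := P.subtype ∘ₗ e.symm.toLinearMap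
  let A : (Fin (M + 1) → ℂ) →ₗ[ℂ] (Fin 4 ⊕ κ → ℂ) := e.toLinearMap ∘ₗ π
  have hB : ∀ i u, φ i (B u) = 0 := fun i u => hP.mp (e.symm u).2 i
  have hBA : ∀ z, (∀ i, φ i z = 0) → B (A z) = z := fun z hz => by
    simp [A, B, hπ' ⟨z, hP.mpr hz⟩]
  have hBq : linPullback B (chartComp 2 G v j) = quadric c := MvPolynomial.funext fun u => by
    rw [eval_linPullback, ← hQ, ← e.apply_symm_apply u, ← he, e.apply_symm_apply]
    rfl
  have hset : ({X j, linForm _ φ₁, linForm _ φ₂, chartComp 2 G v j, chartShift G v j} :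
      Set (MvPolynomial (Fin (M + 1)) ℂ)) =
      (Set.range fun i => linForm _ (φ i)) ∪ {chartComp 2 G v j, chartShift G v j} := by
    have hr : (Set.range fun i => linForm (Fin (M + 1)) (φ i)) =
        {X j, linForm _ φ₁, linForm _ φ₂} := by
      ext p
      simp [Fin.exists_fin_succ, φ, linForm_proj, eq_comm]
    rw [hr]
    simp only [Set.insert_union, Set.singleton_union]
  rw [hset, Ideal.span_union]
  refine isPrime_sup_span_pair φ B A hB hBA _ _ ?_
  rw [hBq]
  refine isPrime_span_quadric_pair hM c ((totalDegree_linPullback_le B _).trans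
    ((totalDegree_chartShift_le G v j).trans hG.totalDegree_le)) (fun k hk => ?_)
    (hasNoCone_linPullback hreg hv φ rfl B A hB hBA)
  rw [homogeneousComponent_linPullback]
  interval_cases k
  · have h0 : coeff 0 (chartShift G v j) = 0 := by
      rw [← constantCoeff_eq, ← eval_zero, eval_chartShift rfl, add_zero, hvG]
    rw [homogeneousComponent_zero, h0, C_0, map_zero]
    exact Ideal.zero_mem _
  · change linPullback B (chartComp 1 G v j) ∈ _
    rw [hsing, map_zero]
    exact Ideal.zero_mem _
  · change linPullback B (chartComp 2 G v j) ∈ _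
    rw [hBq]
    exact Ideal.mem_span_singleton_self _
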